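/- arXiv:2212.14251 — 7 statements merged into one kernel-verified Lean document; each statement's English description precedes it below -/
import Mathlib

section
/- Let d ≥ 2 be an integer and let α ≥ 0 be a real number with α > 1 − d/2. Then, as u → 0 in ℝ^d \ {0}, the integral ∫_{Δ₂} (t−s)^{−α} p^d_{t−s}(u) ds dt is asymptotically equivalent to 2^{α−1} Γ(α + d/2 − 1) / (π^{d/2} ‖u‖^{2α+d−2}); that is, lim_{u→0} ‖u‖^{2α+d−2} ∫_{Δ₂} (t−s)^{−α} p^d_{t−s}(u) ds dt = 2^{α−1} Γ(α + d/2 − 1) / π^{d/2}. -/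
open MeasureTheory Real Filter

/-- The `d`-dimensional Gaussian density with variance parameter `ε`. -/
noncomputable def gaussD (d : ℕ) (ε : ℝ) (z : EuclideanSpace ℝ (Fin d)) : ℝ :=
  (2 * Real.pi * ε) ^ (-(d : ℝ) / 2) * Real.exp (-‖z‖ ^ 2 / (2 * ε))

/-- The simplex `Δ₂ = {(s,t) ∈ [0,1]² : s < t}`. -/
def Delta2 : Set (ℝ × ℝ) := {p | 0 ≤ p.1 ∧ p.1 < p.2 ∧ p.2 ≤ 1}

open Set Topology
open scoped ENNReal

lemma measurableSet_Delta2 : MeasurableSet Delta2 :=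
  (measurableSet_le measurable_const measurable_fst).inter
    ((measurableSet_lt measurable_fst measurable_snd).inter
      (measurableSet_le measurable_snd measurable_const))

/-- Integrating a function of `t - s` over the simplex reduces to a weighted integral in
`r = t - s`. -/
lemma lintegral_Delta2_sub {g : ℝ → ℝ≥0∞} (hg : Measurable g) :
    ∫⁻ p in Delta2, g (p.2 - p.1) = ∫⁻ r in Ioi (0 : ℝ), ENNReal.ofReal (1 - r) * g r := by
  have hind : ∀ s r : ℝ, Delta2.indicator (fun p : ℝ × ℝ => g (p.2 - p.1)) (s, r + s)
      = (Ioi (0 : ℝ)).indicator g r * (Icc 0 (1 - r)).indicator 1 s := by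
    intro s r
    have hiff : (s, r + s) ∈ Delta2 ↔ r ∈ Ioi (0 : ℝ) ∧ s ∈ Icc 0 (1 - r) := by
      simp only [Delta2, mem_ofPred_eq, mem_Ioi, mem_Icc]
      constructor
      · rintro ⟨h₁, h₂, h₃⟩
        exact ⟨by linarith, h₁, by linarith⟩
      · rintro ⟨h₁, h₂, h₃⟩
        exact ⟨h₂, by linarith, by linarith⟩
    by_cases hr : r ∈ Ioi (0 : ℝ) <;> by_cases hs : s ∈ Icc 0 (1 - r) <;>
      simp only [indicator, hiff, hr, hs, and_true, and_false, if_true, if_false, Pi.one_apply,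
        mul_one, mul_zero, add_sub_cancel_right]
  have hmeas : Measurable (Delta2.indicator fun p : ℝ × ℝ => g (p.2 - p.1)) :=
    (hg.comp (measurable_snd.sub measurable_fst)).indicator measurableSet_Delta2
  rw [← lintegral_indicator measurableSet_Delta2, Measure.volume_eq_prod, lintegral_prod _ hmeas.aemeasurable]
  have hshift : ∀ s : ℝ, ∫⁻ t, Delta2.indicator (fun p : ℝ × ℝ => g (p.2 - p.1)) (s, t)
      = ∫⁻ r, Delta2.indicator (fun p : ℝ × ℝ => g (p.2 - p.1)) (s, r + s) := fun s =>
    (lintegral_add_right_eq_self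
      (fun t => Delta2.indicator (fun p : ℝ × ℝ => g (p.2 - p.1)) (s, t)) s).symm
  simp_rw [hshift]
  have hmeas_shift : Measurable (Function.uncurry fun s r : ℝ =>
      Delta2.indicator (fun p : ℝ × ℝ => g (p.2 - p.1)) (s, r + s)) :=
    hmeas.comp (measurable_fst.prodMk (measurable_snd.add measurable_fst))
  rw [lintegral_lintegral_swap hmeas_shift.aemeasurable, ← lintegral_indicator measurableSet_Ioi]
  congr 1 with r
  simp_rw [hind]
  rw [lintegral_const_mul _ (measurable_one.indicator measurableSet_Icc),
    lintegral_indicator_one measurableSet_Icc, Real.volume_Icc, sub_zero]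
  by_cases hr : r ∈ Ioi (0 : ℝ)
  · simp only [indicator_of_mem hr, mul_comm]
  · simp only [indicator_of_notMem hr, zero_mul]

lemma setIntegral_Delta2_sub {f : ℝ → ℝ} (hf : Measurable f) (hf0 : ∀ r, 0 < r → 0 ≤ f r) :
    ∫ p in Delta2, f (p.2 - p.1) = ∫ r in Ioi (0 : ℝ), max (1 - r) 0 * f r := by
  rw [integral_eq_lintegral_of_nonneg_ae, integral_eq_lintegral_of_nonneg_ae,
    lintegral_Delta2_sub (g := fun r => ENNReal.ofReal (f r)) hf.ennreal_ofReal]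
  · congr 1
    refine lintegral_congr fun r => ?_
    rw [ENNReal.ofReal_mul (le_max_right _ _)]
    congr 1
    rcases le_total (1 - r) 0 with h | h
    · rw [max_eq_right h, ENNReal.ofReal_of_nonpos h, ENNReal.ofReal_zero]
    · rw [max_eq_left h]
  · exact ae_restrict_of_forall_mem measurableSet_Ioi
      fun r hr => mul_nonneg (le_max_right _ _) (hf0 r hr)
  · exact (((measurable_const.sub measurable_id).max measurable_const).mul hf).aestronglyMeasurable
  · exact ae_restrict_of_forall_mem measurableSet_Delta2 fun p hp => hf0 _ (sub_pos.2 hp.2.1)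
  · exact (hf.comp (measurable_snd.sub measurable_fst)).aestronglyMeasurable

/-- The substitution `r = a / x`. -/
lemma integral_rpow_neg_mul_exp_neg_div {a γ : ℝ} (ha : 0 < a) :
    a ^ (γ - 1) * ∫ r in Ioi (0 : ℝ), max (1 - r) 0 * (r ^ (-γ) * Real.exp (-a / r)) =
      ∫ x in Ioi (0 : ℝ), max (1 - a / x) 0 * (Real.exp (-x) * x ^ (γ - 1 - 1)) := by
  set h : ℝ → ℝ := fun r => max (1 - r) 0 * (r ^ (-γ) * Real.exp (-a / r)) with hh
  have hscale : ∫ r in Ioi (0 : ℝ), h r = a * ∫ y in Ioi (0 : ℝ), h (a * y) := by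
    rw [integral_comp_mul_left_Ioi h 0 ha, mul_zero, smul_eq_mul, mul_inv_cancel_left₀ ha.ne']
  rw [hscale, ← integral_comp_rpow_Ioi (fun y => h (a * y)) (p := -1) (by norm_num),
    ← mul_assoc, ← integral_const_mul]
  refine setIntegral_congr_fun measurableSet_Ioi fun x hx => ?_
  have hx' : 0 < x := hx
  have hexp : -a / (a * x⁻¹) = -x := by field_simp
  have hpow : a ^ (γ - 1) * a * (x ^ ((-1 : ℝ) - 1) * (a * x⁻¹) ^ (-γ)) = x ^ (γ - 1 - 1) := by
    rw [Real.mul_rpow ha.le (inv_nonneg.2 hx'.le), Real.inv_rpow hx'.le, Real.rpow_neg hx'.le γ,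
      inv_inv, ← Real.rpow_add_one ha.ne']
    rw [show a ^ (γ - 1 + 1) * (x ^ ((-1 : ℝ) - 1) * (a ^ (-γ) * x ^ γ))
      = (a ^ (γ - 1 + 1) * a ^ (-γ)) * (x ^ ((-1 : ℝ) - 1) * x ^ γ) by ring,
      ← Real.rpow_add ha, ← Real.rpow_add hx']
    rw [show γ - 1 + 1 + -γ = 0 by ring, Real.rpow_zero, one_mul]
    congr 1
    ring
  simp only [hh, smul_eq_mul, Real.rpow_neg_one, hexp, abs_neg, abs_one, one_mul, ← hpow,
    div_eq_mul_inv a x]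
  ring

lemma tendsto_integral_max_mul_Gamma {β : ℝ} (hβ : 0 < β) :
    Tendsto (fun a : ℝ => ∫ x in Ioi (0 : ℝ), max (1 - a / x) 0 * (Real.exp (-x) * x ^ (β - 1)))
      (𝓝[>] 0) (𝓝 (Real.Gamma β)) := by
  rw [Real.Gamma_eq_integral hβ]
  refine tendsto_integral_filter_of_dominated_convergence
    (fun x => Real.exp (-x) * x ^ (β - 1)) ?_ ?_ (Real.GammaIntegral_convergent hβ) ?_
  · exact Eventually.of_forall fun a => Measurable.aestronglyMeasurable (by fun_prop)
  · filter_upwards [self_mem_nhdsWithin] with a ha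
    refine ae_restrict_of_forall_mem measurableSet_Ioi fun x hx => ?_
    have hx' : 0 < x := hx
    have ha' : 0 < a := ha
    have hq : 0 < a / x := div_pos ha' hx'
    have hpos : 0 ≤ Real.exp (-x) * x ^ (β - 1) := by positivity
    rw [Real.norm_of_nonneg (mul_nonneg (le_max_right _ _) hpos)]
    exact mul_le_of_le_one_left hpos (max_le (by linarith) zero_le_one)
  · refine ae_of_all _ fun x => ?_
    have hcont : Continuous fun a : ℝ =>
        max (1 - a / x) 0 * (Real.exp (-x) * x ^ (β - 1)) := by fun_prop
    simpa using (hcont.tendsto 0).mono_left nhdsWithin_le_nhds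

theorem stmt0 (d : ℕ) (hd : 2 ≤ d) (α : ℝ) (hα0 : 0 ≤ α) (hα : 1 - (d : ℝ) / 2 < α) :
    Tendsto
      (fun u : EuclideanSpace ℝ (Fin d) =>
        ‖u‖ ^ (2 * α + d - 2) *
          ∫ p in Delta2, (p.2 - p.1) ^ (-α) * gaussD d (p.2 - p.1) u)
      (nhdsWithin 0 {0}ᶜ)
      (nhds ((2 : ℝ) ^ (α - 1) * Real.Gamma (α + d / 2 - 1) / Real.pi ^ ((d : ℝ) / 2))) := by
  set γ : ℝ := α + d / 2 with hγ
  have hβ : 0 < γ - 1 := by rw [hγ]; linarith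
  have ha : Tendsto (fun u : EuclideanSpace ℝ (Fin d) => ‖u‖ ^ 2 / 2) (𝓝[{0}ᶜ] 0) (𝓝[>] 0) := by
    refine tendsto_nhdsWithin_iff.2 ⟨?_, ?_⟩
    · have hcont : Continuous fun u : EuclideanSpace ℝ (Fin d) => ‖u‖ ^ 2 / 2 := by fun_prop
      simpa using (hcont.tendsto 0).mono_left nhdsWithin_le_nhds
    · filter_upwards [self_mem_nhdsWithin] with u hu
      have hu' : 0 < ‖u‖ := norm_pos_iff.2 hu
      exact mem_Ioi.2 (by positivity)
  have hlim := ((tendsto_integral_max_mul_Gamma hβ).comp ha).const_mul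
    ((2 : ℝ) ^ (γ - 1) * (2 * Real.pi) ^ (-(d : ℝ) / 2))
  have hconst : (2 : ℝ) ^ (γ - 1) * (2 * Real.pi) ^ (-(d : ℝ) / 2) * Real.Gamma (γ - 1)
      = (2 : ℝ) ^ (α - 1) * Real.Gamma (γ - 1) / Real.pi ^ ((d : ℝ) / 2) := by
    rw [Real.mul_rpow zero_le_two Real.pi_pos.le, ← mul_assoc, ← Real.rpow_add zero_lt_two,
      neg_div, Real.rpow_neg Real.pi_pos.le, show γ - 1 + -((d : ℝ) / 2) = α - 1 by rw [hγ]; ring]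
    ring
  rw [hconst] at hlim
  refine hlim.congr' ?_
  filter_upwards [self_mem_nhdsWithin] with u hu
  have hu' : 0 < ‖u‖ := norm_pos_iff.2 hu
  have hnorm : ‖u‖ ^ (2 * α + d - 2) = (2 : ℝ) ^ (γ - 1) * (‖u‖ ^ 2 / 2) ^ (γ - 1) := by
    rw [← Real.mul_rpow zero_le_two (by positivity), mul_div_cancel₀ _ two_ne_zero,
      ← Real.rpow_natCast, ← Real.rpow_mul hu'.le]
    congr 1
    push_cast
    rw [hγ]
    ring
  have hmeas : Measurable fun r : ℝ => r ^ (-α) * gaussD d r u := by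
    unfold gaussD
    fun_prop
  have hnonneg : ∀ r : ℝ, 0 < r → 0 ≤ r ^ (-α) * gaussD d r u := by
    intro r hr
    unfold gaussD
    positivity
  have hint : ∫ r in Ioi (0 : ℝ), max (1 - r) 0 * (r ^ (-α) * gaussD d r u)
      = (2 * Real.pi) ^ (-(d : ℝ) / 2) * ∫ r in Ioi (0 : ℝ),
        max (1 - r) 0 * (r ^ (-γ) * Real.exp (-(‖u‖ ^ 2 / 2) / r)) := by
    rw [← integral_const_mul]
    refine setIntegral_congr_fun measurableSet_Ioi fun r hr => ?_
    have hr' : 0 < r := hr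
    have hsplit : r ^ (-γ) = r ^ (-α) * r ^ (-(d : ℝ) / 2) := by
      rw [← Real.rpow_add hr']
      congr 1
      rw [hγ]
      ring
    have hexp : -‖u‖ ^ 2 / (2 * r) = -(‖u‖ ^ 2 / 2) / r := by field_simp
    simp only [gaussD, hsplit, hexp, Real.mul_rpow Real.two_pi_pos.le hr'.le]
    ring
  rw [setIntegral_Delta2_sub hmeas hnonneg, hint, hnorm, Function.comp_apply,
    ← integral_rpow_neg_mul_exp_neg_div (by positivity)]
  ring
end

section
/- Let d = 2. Then, as u → 0 in ℝ² \ {0}, the integral ∫_{Δ₂} p²_{t−s}(u) ds dt is asymptotically equivalent to (1/π) log(1/‖u‖); that is, lim_{u→0} (∫_{Δ₂} p²_{t−s}(u) ds dt) / log(1/‖u‖) = 1/π. -/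
open MeasureTheory Real Filter

/-- Integrating a bounded function of `t - s` over the simplex reduces to a one-variable integral. -/
lemma setIntegral_Delta2_sub_s1 {F : ℝ → ℝ} (hF : Measurable F) {C : ℝ}
    (hC : ∀ x, 0 < x → |F x| ≤ C) :
    ∫ p in Delta2, F (p.2 - p.1) = ∫ x in (0 : ℝ)..1, (1 - x) * F x := by
  have hmp : MeasurePreserving (fun z : ℝ × ℝ => (z.2, z.2 + z.1)) volume volume :=
    measurePreserving_prod_add_swap (volume : Measure ℝ) (volume : Measure ℝ)
  have hemb : MeasurableEmbedding (fun z : ℝ × ℝ => (z.2, z.2 + z.1)) :=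
    (MeasurableEquiv.shearAddRight ℝ).measurableEmbedding.comp
      MeasurableEquiv.prodComm.measurableEmbedding
  rw [← hmp.setIntegral_preimage_emb hemb]
  simp only [add_sub_cancel_left]
  set T : Set (ℝ × ℝ) := (fun z : ℝ × ℝ => (z.2, z.2 + z.1)) ⁻¹' Delta2 with hT
  have memT : ∀ x s : ℝ, (x, s) ∈ T ↔ 0 ≤ s ∧ 0 < x ∧ s + x ≤ 1 := by
    intro x s
    simp [hT, Delta2]
  have hTm : MeasurableSet T := by
    have : T = {z : ℝ × ℝ | 0 ≤ z.2} ∩ ({z | 0 < z.1} ∩ {z | z.2 + z.1 ≤ 1}) := by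
      ext ⟨x, s⟩
      simp [memT]
    rw [this]
    exact (measurableSet_le (by fun_prop) (by fun_prop)).inter
      ((measurableSet_lt (by fun_prop) (by fun_prop)).inter
        (measurableSet_le (by fun_prop) (by fun_prop)))
  have hTfin : volume T < ⊤ := by
    refine lt_of_le_of_lt (measure_mono (t := Set.Icc 0 1 ×ˢ Set.Icc 0 1) ?_)
      (isCompact_Icc.prod isCompact_Icc).measure_lt_top
    rintro ⟨x, s⟩ h
    obtain ⟨h1, h2, h3⟩ := (memT x s).1 h
    exact ⟨⟨h2.le, by simp only; linarith⟩, ⟨h1, by simp only; linarith⟩⟩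
  have hint : IntegrableOn (fun z : ℝ × ℝ => F z.1) T := by
    refine Measure.integrableOn_of_bounded (M := C) hTfin.ne
      (hF.comp measurable_fst).aestronglyMeasurable ?_
    filter_upwards [ae_restrict_mem hTm] with z hz
    exact hC _ ((memT z.1 z.2).1 hz).2.1
  rw [← integral_indicator hTm, Measure.volume_eq_prod, integral_prod _ (by
    rw [← Measure.volume_eq_prod]; exact hint.integrable_indicator hTm),
    intervalIntegral.integral_of_le zero_le_one, ← integral_indicator measurableSet_Ioc]
  congr 1 with x
  by_cases hx : x ∈ Set.Ioc (0 : ℝ) 1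
  · have : (fun s => T.indicator (fun z : ℝ × ℝ => F z.1) (x, s)) =
        (Set.Icc 0 (1 - x)).indicator (fun _ => F x) := by
      ext s
      refine Set.indicator_eq_indicator ?_ rfl
      simp only [memT, Set.mem_Icc, hx.1, true_and, le_sub_iff_add_le]
    rw [this, integral_indicator measurableSet_Icc, Set.indicator_of_mem hx]
    simp [hx.2]
  · have : (fun s => T.indicator (fun z : ℝ × ℝ => F z.1) (x, s)) = fun _ => 0 := by
      ext s
      refine Set.indicator_of_notMem (fun h => hx ?_) _
      obtain ⟨h1, h2, h3⟩ := (memT x s).1 h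
      exact ⟨h2, by linarith⟩
    rw [this, Set.indicator_of_notMem hx, integral_zero]

/-- Pointwise bound on the unnormalised planar heat kernel, uniform in time. -/
lemma inv_mul_exp_neg_sq_div_le {r x : ℝ} (hr : 0 < r) (hx : 0 < x) :
    x⁻¹ * exp (-r ^ 2 / (2 * x)) ≤ 2 / r ^ 2 := by
  have h := Real.add_one_le_exp (r ^ 2 / (2 * x))
  have hpos : 0 < r ^ 2 / (2 * x) := by positivity
  rw [neg_div, Real.exp_neg]
  calc x⁻¹ * (exp (r ^ 2 / (2 * x)))⁻¹ ≤ x⁻¹ * (r ^ 2 / (2 * x))⁻¹ := by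
        gcongr
        linarith
    _ = 2 / r ^ 2 := by field_simp

lemma abs_integral_one_sub_mul_inv_mul_exp_sub_log_le {r : ℝ} (hr : 0 < r) (hr1 : r < 1) :
    |(∫ x in (0 : ℝ)..1, (1 - x) * (x⁻¹ * exp (-r ^ 2 / (2 * x)))) - 2 * log (1 / r)| ≤ 2 := by
  have hr2 : 0 < r ^ 2 := by positivity
  have hr21 : r ^ 2 < 1 := by nlinarith
  set g : ℝ → ℝ := fun x => (1 - x) * (x⁻¹ * exp (-r ^ 2 / (2 * x))) with hg
  have hg0 : ∀ x, 0 < x → x ≤ 1 → 0 ≤ g x := fun x h0 h1 =>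
    mul_nonneg (by linarith) (by positivity)
  have hgle : ∀ x, 0 < x → x ≤ 1 → g x ≤ x⁻¹ * exp (-r ^ 2 / (2 * x)) := fun x h0 h1 =>
    mul_le_of_le_one_left (by positivity) (by linarith)
  have hgi : IntervalIntegrable g volume 0 1 := by
    rw [intervalIntegrable_iff_integrableOn_Ioc_of_le zero_le_one]
    refine Measure.integrableOn_of_bounded (M := 2 / r ^ 2) (by simp)
      (Measurable.aestronglyMeasurable (by fun_prop)) ?_
    filter_upwards [ae_restrict_mem measurableSet_Ioc] with x hx
    rw [Real.norm_of_nonneg (hg0 x hx.1 hx.2)]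
    exact (hgle x hx.1 hx.2).trans (inv_mul_exp_neg_sq_div_le hr hx.1)
  have hg1 : IntervalIntegrable g volume 0 (r ^ 2) := hgi.mono_set (by
    rw [Set.uIcc_of_le hr2.le, Set.uIcc_of_le zero_le_one]
    exact Set.Icc_subset_Icc_right hr21.le)
  have hg2 : IntervalIntegrable g volume (r ^ 2) 1 := hgi.mono_set (by
    rw [Set.uIcc_of_le hr21.le, Set.uIcc_of_le zero_le_one]
    exact Set.Icc_subset_Icc_left hr2.le)
  have h0 : (0 : ℝ) ∉ Set.uIcc (r ^ 2) 1 := by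
    rw [Set.uIcc_of_le hr21.le]
    exact fun h => absurd h.1 (by linarith)
  have hne : ∀ x ∈ Set.uIcc (r ^ 2) 1, x ≠ 0 := fun x hx h => h0 (h ▸ hx)
  have hinv : IntervalIntegrable (fun x : ℝ => x⁻¹) volume (r ^ 2) 1 :=
    (continuousOn_inv₀.mono hne).intervalIntegrable
  have hinv2 : IntervalIntegrable (fun x : ℝ => r ^ 2 / 2 * x ^ (-2 : ℤ)) volume (r ^ 2) 1 :=
    (continuousOn_const.mul
      (continuousOn_id.zpow₀ _ fun x hx => Or.inl (hne x hx))).intervalIntegrable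
  have hlog : ∫ x in (r ^ 2)..1, x⁻¹ = 2 * log (1 / r) := by
    rw [integral_inv h0, one_div, one_div, Real.log_inv, Real.log_inv, Real.log_pow]
    push_cast
    ring
  have hsq : ∫ x in (r ^ 2)..1, r ^ 2 / 2 * x ^ (-2 : ℤ) = (1 - r ^ 2) / 2 := by
    rw [intervalIntegral.integral_const_mul, integral_zpow (Or.inr ⟨by norm_num, h0⟩)]
    norm_num
    field_simp
    ring
  have near_nonneg : 0 ≤ ∫ x in (0 : ℝ)..(r ^ 2), g x := by
    rw [intervalIntegral.integral_of_le hr2.le]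
    exact setIntegral_nonneg measurableSet_Ioc fun x hx => hg0 x hx.1 (hx.2.trans hr21.le)
  have near_le : ∫ x in (0 : ℝ)..(r ^ 2), g x ≤ 2 := by
    have := intervalIntegral.integral_mono_on_of_le_Ioo hr2.le hg1
      (intervalIntegrable_const (c := 2 / r ^ 2)) fun x hx =>
        (hgle x hx.1 (hx.2.le.trans hr21.le)).trans (inv_mul_exp_neg_sq_div_le hr hx.1)
    rw [intervalIntegral.integral_const, sub_zero, smul_eq_mul, mul_div_cancel₀ _ hr2.ne'] at this
    exact this
  have far_le : ∫ x in (r ^ 2)..1, g x ≤ 2 * log (1 / r) := by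
    rw [← hlog]
    refine intervalIntegral.integral_mono_on hr21.le hg2 hinv fun x hx => ?_
    have hx0 : 0 < x := hr2.trans_le hx.1
    refine (hgle x hx0 hx.2).trans (mul_le_of_le_one_right (by positivity) ?_)
    rw [Real.exp_le_one_iff, neg_div]
    exact neg_nonpos.2 (by positivity)
  have le_far : 2 * log (1 / r) - (1 - r ^ 2) - (1 - r ^ 2) / 2 ≤ ∫ x in (r ^ 2)..1, g x := by
    have hone : ∫ _ in (r ^ 2)..1, (1 : ℝ) = 1 - r ^ 2 := by simp
    rw [← hsq, ← hlog, ← hone, ← intervalIntegral.integral_sub hinv intervalIntegrable_const,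
      ← intervalIntegral.integral_sub (hinv.sub intervalIntegrable_const) hinv2]
    refine intervalIntegral.integral_mono_on hr21.le
      ((hinv.sub intervalIntegrable_const).sub hinv2) hg2 fun x hx => ?_
    have hx0 : 0 < x := hr2.trans_le hx.1
    have he := Real.add_one_le_exp (-r ^ 2 / (2 * x))
    calc x⁻¹ - 1 - r ^ 2 / 2 * x ^ (-2 : ℤ)
        ≤ x⁻¹ - 1 - r ^ 2 / 2 * x ^ (-2 : ℤ) + r ^ 2 / (2 * x) :=
          le_add_of_nonneg_right (by positivity)
      _ = (1 - x) * (x⁻¹ * (-r ^ 2 / (2 * x) + 1)) := by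
          rw [zpow_neg]
          norm_cast
          field_simp
          ring
      _ ≤ g x := by
          have : 0 ≤ 1 - x := by linarith [hx.2]
          simp only [hg]
          gcongr
  rw [← intervalIntegral.integral_add_adjacent_intervals hg1 hg2, abs_le]
  constructor <;> linarith

lemma setIntegral_Delta2_gaussD_two {u : EuclideanSpace ℝ (Fin 2)} (hu : u ≠ 0) :
    ∫ p in Delta2, gaussD 2 (p.2 - p.1) u =
      (2 * π)⁻¹ * ∫ x in (0 : ℝ)..1, (1 - x) * (x⁻¹ * exp (-‖u‖ ^ 2 / (2 * x))) := by
  have hgauss : ∀ x, gaussD 2 x u = (2 * π)⁻¹ * (x⁻¹ * exp (-‖u‖ ^ 2 / (2 * x))) := by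
    intro x
    have : -((2 : ℕ) : ℝ) / 2 = -1 := by norm_num
    rw [gaussD, this, Real.rpow_neg_one, mul_inv, mul_assoc]
  simp only [hgauss]
  rw [integral_const_mul, setIntegral_Delta2_sub_s1 (F := fun x => x⁻¹ * exp (-‖u‖ ^ 2 / (2 * x)))
    (C := 2 / ‖u‖ ^ 2) (by fun_prop)]
  intro x hx
  rw [abs_of_nonneg (by positivity)]
  exact inv_mul_exp_neg_sq_div_le (norm_pos_iff.2 hu) hx

theorem stmt1 :
    Tendsto
      (fun u : EuclideanSpace ℝ (Fin 2) =>
        (∫ p in Delta2, gaussD 2 (p.2 - p.1) u) / Real.log (1 / ‖u‖))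
      (nhdsWithin 0 {0}ᶜ) (nhds (1 / Real.pi)) := by
  have hnorm : Tendsto (fun u : EuclideanSpace ℝ (Fin 2) => ‖u‖) (nhdsWithin 0 {0}ᶜ)
      (nhdsWithin 0 (Set.Ioi 0)) := tendsto_norm_nhdsNE_zero
  have hlog : Tendsto (fun u : EuclideanSpace ℝ (Fin 2) => log (1 / ‖u‖)) (nhdsWithin 0 {0}ᶜ)
      atTop := by
    simp only [one_div]
    exact Real.tendsto_log_atTop.comp (tendsto_inv_nhdsGT_zero.comp hnorm)
  rw [tendsto_iff_norm_sub_tendsto_zero]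
  refine squeeze_zero' (Eventually.of_forall fun _ => norm_nonneg _) ?_
    (hlog.const_div_atTop (π⁻¹))
  have hlt : ∀ᶠ u : EuclideanSpace ℝ (Fin 2) in nhdsWithin 0 {0}ᶜ, ‖u‖ < 1 :=
    hnorm.eventually (nhdsWithin_le_nhds (Iio_mem_nhds one_pos))
  filter_upwards [self_mem_nhdsWithin, hlt, hlog.eventually_gt_atTop 0] with u hu hu1 hL
  rw [setIntegral_Delta2_gaussD_two hu, Real.norm_eq_abs]
  have hb := abs_integral_one_sub_mul_inv_mul_exp_sub_log_le (norm_pos_iff.2 hu) hu1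
  set J := ∫ x in (0 : ℝ)..1, (1 - x) * (x⁻¹ * exp (-‖u‖ ^ 2 / (2 * x)))
  set L := log (1 / ‖u‖)
  have : (2 * π)⁻¹ * J / L - 1 / π = (2 * π)⁻¹ * (J - 2 * L) / L := by
    field_simp
  rw [this, abs_div, abs_mul, abs_of_pos hL, abs_of_pos (by positivity : 0 < (2 * π)⁻¹)]
  calc (2 * π)⁻¹ * |J - 2 * L| / L ≤ (2 * π)⁻¹ * 2 / L := by gcongr
    _ = π⁻¹ / L := by field_simp
end

section
/- For every n ∈ ℕ, every δ ∈ (0,1], and every a ∈ ℝ, the probabilist's Hermite polynomial satisfies δ^{n/2} |H_n(a/√δ)| ≤ n! √e · e^{|a|}. In particular, for a one-dimensional continuous path W and 0 ≤ s < t ≤ 1, |H_n((W(t)−W(s))/√(t−s))| ≤ (n! √e / (t−s)^{n/2}) exp(|W(t)−W(s)|). -/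
open Real

/-- The probabilist's Hermite polynomial `H_n`, evaluated at a real number. -/
noncomputable def H (n : ℕ) (x : ℝ) : ℝ := Polynomial.aeval x (Polynomial.hermite n)

/-- The coefficients of the Hermite polynomials satisfy `|[x ^ k] H_n| * k! ≤ n!`. -/
theorem abs_coeff_hermite_mul_factorial_le {n k : ℕ} (hk : k ≤ n) :
    |(Polynomial.hermite n).coeff k| * (k.factorial : ℤ) ≤ n.factorial := by
  rcases Nat.even_or_odd (n + k) with h | h
  · obtain ⟨m, rfl⟩ : ∃ m, n = 2 * m + k := by
      obtain ⟨r, hr⟩ := h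
      exact ⟨r - k, by omega⟩
    rw [Polynomial.coeff_hermite_explicit, abs_mul, abs_mul, abs_pow, abs_neg, abs_one, one_pow,
      one_mul, Nat.abs_cast, Nat.abs_cast]
    norm_cast
    have hd : (2 * m - 1).doubleFactorial ≤ (2 * m).factorial :=
      (Nat.doubleFactorial_le_factorial _).trans (Nat.factorial_le (Nat.sub_le _ _))
    calc (2 * m - 1).doubleFactorial * (2 * m + k).choose k * k.factorial
        ≤ (2 * m).factorial * (2 * m + k).choose k * k.factorial := by gcongr
      _ = (2 * m + k).factorial := by
        rw [← Nat.choose_mul_factorial_mul_factorial (Nat.le_add_left k (2 * m)),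
          Nat.add_sub_cancel]
        ring
  · rw [Polynomial.coeff_hermite_of_odd_add h]
    simp

/-- A rescaled Hermite polynomial is dominated by `n!` times the exponential series. -/
theorem pow_mul_abs_H_div_le (n : ℕ) {r : ℝ} (hr : 0 < r) (hr1 : r ≤ 1) (a : ℝ) :
    r ^ n * |H n (a / r)| ≤ n.factorial * exp |a| := by
  have hterm : ∀ k ∈ Finset.range (n + 1),
      r ^ n * |((Polynomial.hermite n).coeff k : ℝ) * (a / r) ^ k| ≤
        n.factorial * (|a| ^ k / k.factorial) := by
    intro k hk
    have hkn : k ≤ n := Nat.lt_succ_iff.mp (Finset.mem_range.mp hk)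
    have hc : |((Polynomial.hermite n).coeff k : ℝ)| * k.factorial ≤ n.factorial := by
      exact_mod_cast abs_coeff_hermite_mul_factorial_le hkn
    have hf : (0 : ℝ) < k.factorial := by positivity
    calc r ^ n * |((Polynomial.hermite n).coeff k : ℝ) * (a / r) ^ k|
        = r ^ (n - k) * (|((Polynomial.hermite n).coeff k : ℝ)| * |a| ^ k) := by
          rw [abs_mul, abs_pow, abs_div, abs_of_pos hr, div_pow, ← pow_sub_mul_pow r hkn]
          field_simp
      _ ≤ 1 * (n.factorial / k.factorial * |a| ^ k) := by
          gcongr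
          · exact pow_le_one₀ hr.le hr1
          · rwa [le_div_iff₀ hf]
      _ = n.factorial * (|a| ^ k / k.factorial) := by ring
  have hH : H n (a / r) =
      ∑ k ∈ Finset.range (n + 1), ((Polynomial.hermite n).coeff k : ℝ) * (a / r) ^ k := by
    rw [H, Polynomial.aeval_eq_sum_range, Polynomial.natDegree_hermite]
    simp
  calc r ^ n * |H n (a / r)|
      ≤ r ^ n * ∑ k ∈ Finset.range (n + 1),
          |((Polynomial.hermite n).coeff k : ℝ) * (a / r) ^ k| := by
        rw [hH]
        gcongr
        exact Finset.abs_sum_le_sum_abs _ _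
    _ ≤ n.factorial * ∑ k ∈ Finset.range (n + 1), |a| ^ k / k.factorial := by
        rw [Finset.mul_sum, Finset.mul_sum]
        exact Finset.sum_le_sum hterm
    _ ≤ n.factorial * exp |a| := by
        gcongr
        exact Real.sum_le_exp_of_nonneg (abs_nonneg a) _

theorem rpow_mul_abs_H_div_sqrt_le (n : ℕ) {δ : ℝ} (hδ : 0 < δ) (hδ1 : δ ≤ 1) (a : ℝ) :
    δ ^ ((n : ℝ) / 2) * |H n (a / √δ)| ≤ n.factorial * √(exp 1) * exp |a| := by
  have hpow : δ ^ ((n : ℝ) / 2) = √δ ^ n := by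
    rw [Real.sqrt_eq_rpow, ← Real.rpow_natCast, ← Real.rpow_mul hδ.le]
    ring_nf
  have hsqrt : 1 ≤ √(exp 1) := Real.one_le_sqrt.mpr (Real.one_le_exp zero_le_one)
  rw [hpow]
  calc √δ ^ n * |H n (a / √δ)| ≤ n.factorial * exp |a| :=
        pow_mul_abs_H_div_le n (Real.sqrt_pos.mpr hδ) (Real.sqrt_le_one.mpr hδ1) a
    _ ≤ n.factorial * √(exp 1) * exp |a| := by
        gcongr
        exact le_mul_of_one_le_right (by positivity) hsqrt

theorem stmt4 :
    (∀ (n : ℕ) (δ a : ℝ), δ ∈ Set.Ioc (0 : ℝ) 1 →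
      δ ^ ((n : ℝ) / 2) * |H n (a / Real.sqrt δ)| ≤
        (n.factorial : ℝ) * Real.sqrt (Real.exp 1) * Real.exp |a|) ∧
    (∀ (n : ℕ) (W : ℝ → ℝ), Continuous W → ∀ s t : ℝ, 0 ≤ s → s < t → t ≤ 1 →
      |H n ((W t - W s) / Real.sqrt (t - s))| ≤
        (n.factorial : ℝ) * Real.sqrt (Real.exp 1) / (t - s) ^ ((n : ℝ) / 2) *
          Real.exp |W t - W s|) := by
  refine ⟨fun n δ a hδ => rpow_mul_abs_H_div_sqrt_le n hδ.1 hδ.2 a, ?_⟩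
  intro n W _ s t hs hst ht
  have hδ : 0 < t - s := sub_pos.mpr hst
  rw [div_mul_eq_mul_div, le_div_iff₀' (Real.rpow_pos_of_pos hδ _)]
  exact rpow_mul_abs_H_div_sqrt_le n hδ (by linarith) _
end

section
/- For every δ ∈ (0,1] and every a ∈ ℝ, the maximum of |exp(z a − z² δ/2)| over the complex unit circle {z ∈ ℂ : |z| = 1} satisfies max_{|z|=1} |exp(z a − z² δ/2)| ≤ √e · e^{|a|}. More precisely, this maximum equals exp(a²/(4δ) + δ/2) if |a| ≤ 2δ, and equals exp(|a| − δ/2) if |a| > 2δ. -/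
open Real

theorem norm_cexp_of_norm_eq_one (δ a : ℝ) {z : ℂ} (hz : ‖z‖ = 1) :
    ‖Complex.exp (z * (a : ℂ) - z ^ 2 * (δ : ℂ) / 2)‖
      = Real.exp (z.re * a - δ * z.re ^ 2 + δ / 2) := by
  have h : z.re * z.re + z.im * z.im = 1 := by
    rw [← Complex.normSq_apply, Complex.normSq_eq_norm_sq, hz, one_pow]
  have hre : (z * (a : ℂ) - z ^ 2 * (δ : ℂ) / 2).re
      = z.re * a - (z.re * z.re - z.im * z.im) * δ / 2 := by
    simp [pow_two]
  rw [Complex.norm_exp, hre]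
  congr 1
  linear_combination δ / 2 * h

theorem setOf_norm_cexp_unit_circle (δ a : ℝ) :
    {x : ℝ | ∃ z : ℂ, ‖z‖ = 1 ∧ x = ‖Complex.exp (z * (a : ℂ) - z ^ 2 * (δ : ℂ) / 2)‖}
      = (fun u : ℝ => Real.exp (u * a - δ * u ^ 2 + δ / 2)) '' {u | |u| ≤ 1} := by
  ext x
  constructor
  · rintro ⟨z, hz, rfl⟩
    exact ⟨z.re, hz ▸ Complex.abs_re_le_norm z, (norm_cexp_of_norm_eq_one δ a hz).symm⟩
  · rintro ⟨u, hu, rfl⟩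
    have hu' : 0 ≤ 1 - u ^ 2 := sub_nonneg.2 ((sq_le_one_iff_abs_le_one u).2 hu)
    have hz : ‖(⟨u, √(1 - u ^ 2)⟩ : ℂ)‖ = 1 := by
      rw [← sq_eq_sq₀ (norm_nonneg _) zero_le_one, ← Complex.normSq_eq_norm_sq,
        Complex.normSq_mk, mul_self_sqrt hu']
      ring
    exact ⟨_, hz, (norm_cexp_of_norm_eq_one δ a hz).symm⟩

theorem stmt5 (δ a : ℝ) (hδ : δ ∈ Set.Ioc (0 : ℝ) 1) :
    IsGreatest
      {x : ℝ | ∃ z : ℂ, ‖z‖ = 1 ∧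
        x = ‖Complex.exp (z * (a : ℂ) - z ^ 2 * (δ : ℂ) / 2)‖}
      (if |a| ≤ 2 * δ then Real.exp (a ^ 2 / (4 * δ) + δ / 2)
       else Real.exp (|a| - δ / 2)) ∧
    (if |a| ≤ 2 * δ then Real.exp (a ^ 2 / (4 * δ) + δ / 2)
     else Real.exp (|a| - δ / 2)) ≤ Real.sqrt (Real.exp 1) * Real.exp |a| := by
  obtain ⟨hδ0, hδ1⟩ := hδ
  rw [setOf_norm_cexp_unit_circle, ← Real.exp_half, ← Real.exp_add]
  split_ifs with h
  · refine ⟨⟨⟨a / (2 * δ), ?_, ?_⟩, ?_⟩, ?_⟩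
    · rw [Set.mem_ofPred_eq, abs_div, abs_of_pos (by positivity : 0 < 2 * δ)]
      exact (div_le_one (by positivity)).2 h
    · dsimp only
      congr 1
      field_simp
      ring
    · rintro _ ⟨u, -, rfl⟩
      have key : a ^ 2 / (4 * δ) - (u * a - δ * u ^ 2) = (a - 2 * δ * u) ^ 2 / (4 * δ) := by
        field_simp
        ring
      have : 0 ≤ (a - 2 * δ * u) ^ 2 / (4 * δ) := by positivity
      exact Real.exp_le_exp.2 (by linarith)
    · have : a ^ 2 / (4 * δ) ≤ |a| := by
        rw [div_le_iff₀ (by positivity), ← sq_abs]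
        nlinarith [abs_nonneg a]
      exact Real.exp_le_exp.2 (by linarith)
  · push Not at h
    refine ⟨⟨?_, ?_⟩, Real.exp_le_exp.2 (by linarith)⟩
    · rcases abs_cases a with ⟨ha, -⟩ | ⟨ha, -⟩
      · exact ⟨1, by simp, by dsimp only; rw [ha]; congr 1; ring⟩
      · exact ⟨-1, by simp, by dsimp only; rw [ha]; congr 1; ring⟩
    · rintro _ ⟨u, hu, rfl⟩
      rw [Set.mem_ofPred_eq] at hu
      have hua : u * a ≤ |u| * |a| := abs_mul u a ▸ le_abs_self _
      refine Real.exp_le_exp.2 ?_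
      rw [← sq_abs u]
      nlinarith [mul_nonneg (sub_nonneg.2 hu) (sub_nonneg.2 h.le),
        mul_nonneg hδ0.le (sq_nonneg (1 - |u|))]
end

section
/- Let α ∈ [1/4, 1/2]. Then there exists a constant c > 0 such that for every integer n ≥ 1 and every x ∈ ℝ, |H_n(x) e^{−α x²}| ≤ c √(n!) · n^{−(8α−1)/12}. -/
open Real

open Filter Topology

lemma hasDerivAt_H (n : ℕ) (x : ℝ) : HasDerivAt (H n) (x * H n x - H (n + 1) x) x := by
  have h := (Polynomial.hermite n).hasDerivAt_aeval x
  have e : x * H n x - H (n + 1) x =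
      Polynomial.aeval x (Polynomial.derivative (Polynomial.hermite n)) := by
    simp [H, Polynomial.hermite_succ]
  rw [e]
  exact h

lemma H_zero (x : ℝ) : H 0 x = 1 := by simp [H]

lemma H_one (x : ℝ) : H 1 x = x := by simp [H]

lemma derivative_hermite_succ (n : ℕ) :
    Polynomial.derivative (Polynomial.hermite (n + 1)) =
      ((n : Polynomial ℤ) + 1) * Polynomial.hermite n := by
  induction n with
  | zero => simp
  | succ n ih =>
    rw [Polynomial.hermite_succ (n + 1), Polynomial.derivative_sub, Polynomial.derivative_mul, ih,
      Polynomial.derivative_mul]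
    have e : Polynomial.derivative ((n : Polynomial ℤ) + 1) = 0 := by simp
    rw [e, Polynomial.derivative_X, Polynomial.hermite_succ n]
    push_cast
    ring

lemma H_add_two (n : ℕ) (x : ℝ) : H (n + 2) x = x * H (n + 1) x - (n + 1) * H n x := by
  simp only [H]
  rw [Polynomial.hermite_succ (n + 1), derivative_hermite_succ]
  simp

lemma hasDerivAt_H_succ (n : ℕ) (x : ℝ) : HasDerivAt (H (n + 1)) ((n + 1) * H n x) x := by
  have h := hasDerivAt_H (n + 1) x
  rwa [H_add_two, sub_sub_cancel] at h

lemma H_neg (n : ℕ) (x : ℝ) : H n (-x) = (-1) ^ n * H n x := by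
  induction n using Nat.twoStepInduction with
  | zero => simp [H_zero]
  | one => simp [H_one]
  | more n h₀ h₁ =>
    rw [H_add_two, H_add_two, h₀, h₁]
    ring

lemma abs_H_neg (n : ℕ) (x : ℝ) : |H n (-x)| = |H n x| := by
  simp [H_neg, abs_mul]

lemma sq_H_apply_zero_mul_sqrt_le (n : ℕ) : H n 0 ^ 2 * √((n : ℝ) + 1) ≤ n.factorial := by
  induction n using Nat.twoStepInduction with
  | zero => simp [H_zero]
  | one => simp [H_one]
  | more n h₀ _ =>
    have hn : (0 : ℝ) ≤ n := n.cast_nonneg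
    have key : (n + 1 : ℝ) * √((n : ℝ) + 3) ≤ (n + 2) * √((n : ℝ) + 1) := by
      rw [← abs_of_nonneg (by positivity : 0 ≤ (n + 1 : ℝ) * √((n : ℝ) + 3)),
        ← abs_of_nonneg (by positivity : 0 ≤ (n + 2 : ℝ) * √((n : ℝ) + 1)), ← sq_le_sq,
        mul_pow, mul_pow, Real.sq_sqrt (by positivity), Real.sq_sqrt (by positivity)]
      nlinarith
    have e : ((n + 2).factorial : ℝ) = (n + 2) * (n + 1) * n.factorial := by
      simp only [Nat.factorial_succ]
      push_cast
      ring
    have e' : ((n + 2 : ℕ) : ℝ) + 1 = n + 3 := by push_cast; ring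
    rw [H_add_two, e, e']
    calc (0 * H (n + 1) 0 - (n + 1) * H n 0) ^ 2 * √((n : ℝ) + 3)
        = (n + 1) * H n 0 ^ 2 * ((n + 1) * √((n : ℝ) + 3)) := by ring
      _ ≤ (n + 1) * H n 0 ^ 2 * ((n + 2) * √((n : ℝ) + 1)) := by gcongr
      _ = (n + 2) * (n + 1) * (H n 0 ^ 2 * √((n : ℝ) + 1)) := by ring
      _ ≤ (n + 2) * (n + 1) * n.factorial := by gcongr

lemma sq_H_succ_apply_zero_mul_sqrt_le (n : ℕ) :
    H (n + 1) 0 ^ 2 * √((n : ℝ) + 2) ≤ (n + 1) * n.factorial := by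
  have h := sq_H_apply_zero_mul_sqrt_le (n + 1)
  rw [Nat.factorial_succ] at h
  push_cast at h
  rwa [add_assoc, one_add_one_eq_two] at h

lemma hasDerivAt_exp_neg_mul_sq (a x : ℝ) :
    HasDerivAt (fun x : ℝ => exp (-a * x ^ 2)) (-2 * a * x * exp (-a * x ^ 2)) x := by
  have h := (((hasDerivAt_id x).pow 2).const_mul (-a)).exp
  refine h.congr_deriv ?_
  simp
  ring

/-- The energy `(n + 1) φ² + φ'²` of `φ = H_n e^{-x²/2}` decreases on `[0, ∞)`. -/
lemma sq_H_mul_exp_neg_half_le (n : ℕ) {x : ℝ} (hx : 0 ≤ x) :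
    (n + 1) * (H n x * exp (-(1 / 2) * x ^ 2)) ^ 2 ≤ (n + 1) * H n 0 ^ 2 + H (n + 1) 0 ^ 2 := by
  let F : ℝ → ℝ := fun x => (n + 1) * (H n x * exp (-(1 / 2) * x ^ 2)) ^ 2 +
    (H (n + 1) x * exp (-(1 / 2) * x ^ 2)) ^ 2
  have hF (x : ℝ) :
      HasDerivAt F (-2 * x * (H (n + 1) x * exp (-(1 / 2) * x ^ 2)) ^ 2) x := by
    have hg := hasDerivAt_exp_neg_mul_sq (1 / 2) x
    have h := ((((hasDerivAt_H n x).mul hg).pow 2).const_mul ((n : ℝ) + 1)).add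
      (((hasDerivAt_H_succ n x).mul hg).pow 2)
    refine h.congr_deriv ?_
    simp only [Pi.mul_apply, Nat.cast_ofNat]
    ring
  have hanti : AntitoneOn F (Set.Ici 0) := by
    refine antitoneOn_of_deriv_nonpos (convex_Ici 0)
      (fun x _ => (hF x).continuousAt.continuousWithinAt)
      (fun x _ => (hF x).differentiableAt.differentiableWithinAt) fun x hx => ?_
    rw [interior_Ici] at hx
    rw [(hF x).deriv]
    exact mul_nonpos_of_nonpos_of_nonneg (by linarith [Set.mem_Ioi.1 hx]) (sq_nonneg _)
  have h := hanti Set.self_mem_Ici (Set.mem_Ici.2 hx) hx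
  simp only [F] at h
  norm_num at h
  have h' := sq_nonneg (H (n + 1) x * exp (-(1 / 2) * x ^ 2))
  norm_num at h' ⊢
  linarith

/-- The quadratic form in `(u, v) = (y, y')` that is adapted to the Liouville–Green approximation
of the solutions of `y'' = -(t⁶ - x²/4) y`, with `s` standing for `√(t⁶ - x²/4)`. -/
noncomputable def greenForm (x s u v : ℝ) : ℝ :=
  v ^ 2 / s - x / (4 * s ^ 3) * (u * v) +
    (s + 1 / (8 * s ^ 3) + 3 / 32 * (x ^ 2 / s ^ 5)) * u ^ 2

lemma greenForm_eq (x u v : ℝ) {s : ℝ} (hs : 0 < s) :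
    greenForm x s u v = (v - x / (8 * s ^ 2) * u) ^ 2 / s +
      (s + 1 / (8 * s ^ 3) + 5 / 64 * (x ^ 2 / s ^ 5)) * u ^ 2 := by
  unfold greenForm
  field_simp
  ring

lemma mul_sq_le_greenForm (x u v : ℝ) {s : ℝ} (hs : 0 < s) : s * u ^ 2 ≤ greenForm x s u v := by
  rw [greenForm_eq x u v hs]
  have h₁ : 0 ≤ (v - x / (8 * s ^ 2) * u) ^ 2 / s := by positivity
  have h₂ : 0 ≤ (1 / (8 * s ^ 3) + 5 / 64 * (x ^ 2 / s ^ 5)) * u ^ 2 := by positivity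
  linarith

lemma sq_le_mul_greenForm (x u v : ℝ) {s : ℝ} (hs : 0 < s) :
    v ^ 2 ≤ 3 * s * greenForm x s u v := by
  rw [greenForm_eq x u v hs]
  have h₁ : s * ((v - x / (8 * s ^ 2) * u) ^ 2 / s) = (v - x / (8 * s ^ 2) * u) ^ 2 := by
    field_simp
  have h₂ : s * (5 / 64 * (x ^ 2 / s ^ 5) * u ^ 2) = 5 * (x / (8 * s ^ 2) * u) ^ 2 := by
    field_simp
    ring
  have h₃ : 0 ≤ s * ((s + 1 / (8 * s ^ 3)) * u ^ 2) := by positivity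
  nlinarith [sq_nonneg (v - x / (8 * s ^ 2) * u - x / (8 * s ^ 2) * u)]

lemma hasDerivAt_potential (t x : ℝ) :
    HasDerivAt (fun x : ℝ => t ^ 6 - x ^ 2 / 4) (-(x / 2)) x := by
  refine ((((hasDerivAt_id x).pow 2).div_const 4).const_sub (t ^ 6)).congr_deriv ?_
  simp
  ring

section ODE

variable {t : ℝ} {y y' : ℝ → ℝ}

lemma hasDerivAt_greenForm (hy : ∀ x, HasDerivAt y (y' x) x)
    (hy' : ∀ x, HasDerivAt y' (-(t ^ 6 - x ^ 2 / 4) * y x) x) {x : ℝ}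
    (hx : 0 < t ^ 6 - x ^ 2 / 4) :
    HasDerivAt (fun x => greenForm x √(t ^ 6 - x ^ 2 / 4) (y x) (y' x))
      ((9 / 32 * x / √(t ^ 6 - x ^ 2 / 4) ^ 5 + 15 / 128 * x ^ 3 / √(t ^ 6 - x ^ 2 / 4) ^ 7) *
        y x ^ 2) x := by
  have hq := hasDerivAt_potential t x
  have hs := hq.sqrt hx.ne'
  have hpos := Real.sqrt_pos.2 hx
  have hsq := Real.sq_sqrt hx.le
  have hid := hasDerivAt_id x
  have h := ((((hy' x).pow 2).div hs hpos.ne').sub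
    ((hid.div ((hs.pow 3).const_mul 4) (mul_pos four_pos (pow_pos hpos 3)).ne').mul
      ((hy x).mul (hy' x)))).add
    (((hs.add ((hasDerivAt_const x (1 : ℝ)).div ((hs.pow 3).const_mul 8)
      (mul_pos (by norm_num) (pow_pos hpos 3)).ne')).add
      (((hid.pow 2).div (hs.pow 5) (pow_pos hpos 5).ne').const_mul (3 / 32))).mul ((hy x).pow 2))
  unfold greenForm
  refine h.congr_deriv ?_
  simp only [Pi.mul_apply, Pi.add_apply, Pi.div_apply, Pi.pow_apply, id, Nat.cast_ofNat]
  generalize √(t ^ 6 - x ^ 2 / 4) = s at *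
  rw [← hsq]
  field_simp
  ring

/-- Grönwall's inequality for `greenForm` on the part of the oscillatory region that stays away
from the turning point. -/
lemma greenForm_le (ht : 0 < t) (hy : ∀ x, HasDerivAt y (y' x) x)
    (hy' : ∀ x, HasDerivAt y' (-(t ^ 6 - x ^ 2 / 4) * y x) x) {x : ℝ} (hx₀ : 0 ≤ x)
    (hx : t ^ 2 ≤ t ^ 6 - x ^ 2 / 4) :
    greenForm x √(t ^ 6 - x ^ 2 / 4) (y x) (y' x) ≤ 2 * greenForm 0 (t ^ 3) (y 0) (y' 0) := by
  let F : ℝ → ℝ := fun x => greenForm x √(t ^ 6 - x ^ 2 / 4) (y x) (y' x)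
  let E : ℝ → ℝ := fun x => exp (-(t ^ 6 / 2) * ((t ^ 6 - x ^ 2 / 4) ^ 3)⁻¹)
  have hq {z : ℝ} (hz : z ∈ Set.Icc 0 x) : t ^ 2 ≤ t ^ 6 - z ^ 2 / 4 := by
    nlinarith [hz.1, hz.2]
  have hq0 {z : ℝ} (hz : z ∈ Set.Icc 0 x) : 0 < t ^ 6 - z ^ 2 / 4 :=
    (by positivity : 0 < t ^ 2).trans_le (hq hz)
  have hE {z : ℝ} (hz : z ∈ Set.Icc 0 x) :
      HasDerivAt E (-(3 / 4 * t ^ 6 * z / (t ^ 6 - z ^ 2 / 4) ^ 4) * E z) z := by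
    have hp := hq0 hz
    have h₁ := hasDerivAt_potential t z
    have h := (((h₁.pow 3).inv (by simpa using hp.ne')).const_mul (-(t ^ 6 / 2))).exp
    refine h.congr_deriv ?_
    simp only [E, Pi.pow_apply, Pi.inv_apply, Nat.cast_ofNat]
    rw [mul_comm]
    congr 1
    generalize t ^ 6 - z ^ 2 / 4 = q at hp
    field_simp
    ring
  have hFE {z : ℝ} (hz : z ∈ Set.Icc 0 x) := (hasDerivAt_greenForm hy hy' (hq0 hz)).mul (hE hz)
  have hanti : AntitoneOn (fun z => F z * E z) (Set.Icc 0 x) := by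
    refine antitoneOn_of_deriv_nonpos (convex_Icc 0 x)
      (fun z hz => (hFE hz).continuousAt.continuousWithinAt)
      (fun z hz => (hFE (interior_subset hz)).differentiableAt.differentiableWithinAt)
      fun z hz => ?_
    replace hz := interior_subset hz
    have hp := hq0 hz
    have hz0 := hz.1
    rw [show deriv (fun z => F z * E z) z = _ from (hFE hz).deriv]
    have hspos := Real.sqrt_pos.2 hp
    have hsq := Real.sq_sqrt hp.le
    have hlow := mul_sq_le_greenForm z (y z) (y' z) hspos
    have hEpos : 0 < E z := exp_pos _
    suffices h : (9 / 32 * z / √(t ^ 6 - z ^ 2 / 4) ^ 5 +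
        15 / 128 * z ^ 3 / √(t ^ 6 - z ^ 2 / 4) ^ 7) * y z ^ 2 ≤
        3 / 4 * t ^ 6 * z / (t ^ 6 - z ^ 2 / 4) ^ 4 * F z by
      have := mul_le_mul_of_nonneg_right h hEpos.le
      simp only [F] at this
      linarith
    refine le_trans ?_ (mul_le_mul_of_nonneg_left hlow (by positivity))
    rw [← mul_assoc]
    refine mul_le_mul_of_nonneg_right ?_ (sq_nonneg _)
    generalize √(t ^ 6 - z ^ 2 / 4) = s at *
    rw [← hsq]
    have h₁ : 9 / 32 * z / s ^ 5 + 15 / 128 * z ^ 3 / s ^ 7 =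
        z * (9 / 32 * s ^ 2 + 15 / 128 * z ^ 2) / s ^ 7 := by
      field_simp
    have h₂ : 3 / 4 * t ^ 6 * z / (s ^ 2) ^ 4 * s = z * (3 / 4 * t ^ 6) / s ^ 7 := by
      field_simp
    rw [h₁, h₂]
    gcongr
    nlinarith
  have h := hanti (Set.left_mem_Icc.2 hx₀) (Set.right_mem_Icc.2 hx₀) hx₀
  have hs0 : √(t ^ 6 - 0 ^ 2 / 4) = t ^ 3 := by
    rw [show t ^ 6 - 0 ^ 2 / 4 = (t ^ 3) ^ 2 by ring, Real.sqrt_sq (by positivity)]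
  have hF0 : F 0 = greenForm 0 (t ^ 3) (y 0) (y' 0) := by simp only [F, hs0]
  have hF0pos : 0 ≤ F 0 := by
    rw [hF0]
    exact le_trans (by positivity) (mul_sq_le_greenForm 0 (y 0) (y' 0) (by positivity : 0 < t ^ 3))
  have hE0 : E 0 ≤ 1 := exp_le_one_iff.2 (by
    have : 0 ≤ t ^ 6 / 2 * ((t ^ 6 - 0 ^ 2 / 4) ^ 3)⁻¹ := by
      norm_num
      positivity
    linarith)
  have hEx : 1 / 2 ≤ E x := by
    have h₁ : t ^ 6 / 2 * ((t ^ 6 - x ^ 2 / 4) ^ 3)⁻¹ ≤ 1 / 2 := by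
      rw [← div_eq_mul_inv, div_le_iff₀ (by have := hq0 (Set.right_mem_Icc.2 hx₀); positivity)]
      have := pow_le_pow_left₀ (by positivity) hx 3
      nlinarith
    have h₂ := Real.add_one_le_exp (-(t ^ 6 / 2) * ((t ^ 6 - x ^ 2 / 4) ^ 3)⁻¹)
    simp only [E]
    linarith
  have hFx : 0 ≤ F x :=
    le_trans (by positivity) (mul_sq_le_greenForm x (y x) (y' x)
      (Real.sqrt_pos.2 (hq0 (Set.right_mem_Icc.2 hx₀))))
  change F x ≤ _
  rw [← hF0]
  simp only at h
  nlinarith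

/-- The energy `(t⁶ - x²/4) y² + y'²` controls the derivative up to the turning point. -/
lemma sq_deriv_le_energy (hy : ∀ x, HasDerivAt y (y' x) x)
    (hy' : ∀ x, HasDerivAt y' (-(t ^ 6 - x ^ 2 / 4) * y x) x) {a x : ℝ} (ha : 0 ≤ a)
    (hax : a ≤ x) (hx : 0 ≤ t ^ 6 - x ^ 2 / 4) :
    y' x ^ 2 ≤ (t ^ 6 - a ^ 2 / 4) * y a ^ 2 + y' a ^ 2 := by
  let F : ℝ → ℝ := fun x => (t ^ 6 - x ^ 2 / 4) * y x ^ 2 + y' x ^ 2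
  have hF (x : ℝ) : HasDerivAt F (-(x / 2 * y x ^ 2)) x := by
    have h₁ := hasDerivAt_potential t x
    refine ((h₁.mul ((hy x).pow 2)).add ((hy' x).pow 2)).congr_deriv ?_
    simp only [Pi.pow_apply, Nat.cast_ofNat]
    ring
  have hanti : AntitoneOn F (Set.Ici 0) := by
    refine antitoneOn_of_deriv_nonpos (convex_Ici 0)
      (fun x _ => (hF x).continuousAt.continuousWithinAt)
      (fun x _ => (hF x).differentiableAt.differentiableWithinAt) fun x hx => ?_
    rw [interior_Ici] at hx
    have : 0 < x := hx
    rw [(hF x).deriv]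
    exact neg_nonpos.2 (by positivity)
  have h := hanti (Set.mem_Ici.2 ha) (Set.mem_Ici.2 (ha.trans hax)) hax
  simp only [F] at h
  have : 0 ≤ (t ^ 6 - x ^ 2 / 4) * y x ^ 2 := by positivity
  linarith

/-- Beyond the turning point, a solution that decays at infinity has decreasing absolute value. -/
lemma sq_le_of_turning_point_le (hy : ∀ x, HasDerivAt y (y' x) x)
    (hy' : ∀ x, HasDerivAt y' (-(t ^ 6 - x ^ 2 / 4) * y x) x)
    (hlim : Tendsto (fun x => y x * y' x) atTop (𝓝 0)) {a x : ℝ} (ha : 0 ≤ a)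
    (hax : a ≤ x) (hta : t ^ 6 - a ^ 2 / 4 ≤ 0) : y x ^ 2 ≤ y a ^ 2 := by
  have hg (x : ℝ) := (hy x).mul (hy' x)
  have hmono : MonotoneOn (fun x => y x * y' x) (Set.Ici a) := by
    refine monotoneOn_of_deriv_nonneg (convex_Ici a)
      (fun x _ => (hg x).continuousAt.continuousWithinAt)
      (fun x _ => (hg x).differentiableAt.differentiableWithinAt) fun x hx => ?_
    rw [interior_Ici] at hx
    rw [show deriv (fun x => y x * y' x) x = _ from (hg x).deriv]
    have hx' : a < x := hx
    have hq : 0 ≤ -(t ^ 6 - x ^ 2 / 4) := by nlinarith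
    nlinarith [mul_nonneg hq (sq_nonneg (y x)), sq_nonneg (y' x)]
  have hnonpos {z : ℝ} (hz : a ≤ z) : y z * y' z ≤ 0 :=
    ge_of_tendsto hlim ((eventually_ge_atTop z).mono fun w hw =>
      hmono (Set.mem_Ici.2 hz) (Set.mem_Ici.2 (hz.trans hw)) hw)
  have hanti : AntitoneOn (fun x => y x ^ 2) (Set.Ici a) := by
    refine antitoneOn_of_deriv_nonpos (convex_Ici a)
      (fun x _ => ((hy x).pow 2).continuousAt.continuousWithinAt)
      (fun x _ => ((hy x).pow 2).differentiableAt.differentiableWithinAt) fun x hx => ?_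
    rw [interior_Ici] at hx
    rw [show deriv (fun x => y x ^ 2) x = _ from ((hy x).pow 2).deriv]
    have := hnonpos (le_of_lt hx)
    norm_num
    linarith
  exact hanti Set.self_mem_Ici (Set.mem_Ici.2 hax) hax

/-- Uniform bound for the solutions of `y'' = -(t⁶ - x²/4) y` that decay at `+∞`. -/
lemma mul_sq_le_of_ode (ht : 1 ≤ t) (hy : ∀ x, HasDerivAt y (y' x) x)
    (hy' : ∀ x, HasDerivAt y' (-(t ^ 6 - x ^ 2 / 4) * y x) x)
    (hlim : Tendsto (fun x => y x * y' x) atTop (𝓝 0)) {x : ℝ} (hx : 0 ≤ x) :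
    t * y x ^ 2 ≤ 100 * (t ^ 3 * y 0 ^ 2 + y' 0 ^ 2 / t ^ 3) := by
  have ht0 : 0 < t := by linarith
  set D := t ^ 3 * y 0 ^ 2 + y' 0 ^ 2 / t ^ 3 with hD
  have hDnonneg : 0 ≤ D := by positivity
  have hstart : greenForm 0 (t ^ 3) (y 0) (y' 0) ≤ 2 * D := by
    have h₁ : 1 / (8 * (t ^ 3) ^ 3) ≤ t ^ 3 := by
      rw [div_le_iff₀ (by positivity)]
      have := one_le_pow₀ ht (n := 12)
      nlinarith
    have h₂ := mul_le_mul_of_nonneg_right h₁ (sq_nonneg (y 0))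
    have h₃ : 0 ≤ y' 0 ^ 2 / t ^ 3 := by positivity
    simp only [greenForm]
    norm_num
    norm_num at h₂
    linarith
  have hosc {z : ℝ} (hz0 : 0 ≤ z) (hz : t ^ 2 ≤ t ^ 6 - z ^ 2 / 4) :
      greenForm z √(t ^ 6 - z ^ 2 / 4) (y z) (y' z) ≤ 4 * D := by
    linarith [greenForm_le ht0 hy hy' hz0 hz]
  have hpow : t ^ 2 ≤ t ^ 6 := pow_le_pow_right₀ ht (by norm_num)
  set a := 2 * √(t ^ 6 - t ^ 2) with ha
  have ha0 : 0 ≤ a := by positivity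
  have ha2 : a ^ 2 = 4 * (t ^ 6 - t ^ 2) := by
    rw [ha, mul_pow, Real.sq_sqrt (by linarith)]
    norm_num
  have hqa : t ^ 6 - a ^ 2 / 4 = t ^ 2 := by rw [ha2]; ring
  have hga := hosc ha0 hqa.ge
  rw [hqa, Real.sqrt_sq ht0.le] at hga
  have hya : t * y a ^ 2 ≤ 4 * D := (mul_sq_le_greenForm a (y a) (y' a) ht0).trans hga
  have hya' : y' a ^ 2 ≤ 12 * t * D := by
    refine (sq_le_mul_greenForm a (y a) (y' a) ht0).trans ?_
    calc 3 * t * greenForm a t (y a) (y' a) ≤ 3 * t * (4 * D) := by gcongr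
      _ = 12 * t * D := by ring
  have hmid {z : ℝ} (haz : a ≤ z) (hz : z ≤ 2 * t ^ 3) : t * y z ^ 2 ≤ 100 * D := by
    have hE {w : ℝ} (hw : w ∈ Set.Icc a (2 * t ^ 3)) : |y' w| ≤ 4 * √(t * D) := by
      have hw2 : w ^ 2 ≤ (2 * t ^ 3) ^ 2 := pow_le_pow_left₀ (ha0.trans hw.1) hw.2 2
      have h := sq_deriv_le_energy hy hy' ha0 hw.1 (by nlinarith)
      rw [hqa] at h
      refine abs_le_of_sq_le_sq ?_ (by positivity)
      rw [mul_pow, Real.sq_sqrt (by positivity)]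
      nlinarith
    have hdiff : |y z - y a| ≤ 4 * √(t * D) * (z - a) := by
      have h := (convex_Icc a (2 * t ^ 3)).norm_image_sub_le_of_norm_hasDerivWithin_le
        (f := y) (f' := y') (fun w _ => (hy w).hasDerivWithinAt) (fun w hw => hE hw)
        (Set.left_mem_Icc.2 (haz.trans hz)) ⟨haz, hz⟩
      rwa [Real.norm_eq_abs, Real.norm_eq_abs, abs_of_nonneg (sub_nonneg.2 haz)] at h
    have hlen : t * (z - a) ≤ 2 := by
      by_contra! hcon
      have h₁ : t * a < 2 * t ^ 4 - 2 := by nlinarith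
      have h₂ : (t * a) ^ 2 < (2 * t ^ 4 - 2) ^ 2 :=
        pow_lt_pow_left₀ h₁ (by positivity) (by norm_num)
      rw [mul_pow, ha2] at h₂
      nlinarith [one_le_pow₀ ht (n := 4)]
    have hdiff2 : t * (y z - y a) ^ 2 ≤ 64 * D := by
      have h₁ : (y z - y a) ^ 2 ≤ (4 * √(t * D) * (z - a)) ^ 2 := by
        rw [← sq_abs]
        exact pow_le_pow_left₀ (abs_nonneg _) hdiff 2
      rw [mul_pow, mul_pow, Real.sq_sqrt (by positivity)] at h₁
      have h₂ : (t * (z - a)) ^ 2 ≤ 2 ^ 2 :=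
        pow_le_pow_left₀ (mul_nonneg ht0.le (sub_nonneg.2 haz)) hlen 2
      calc t * (y z - y a) ^ 2 ≤ t * (4 ^ 2 * (t * D) * (z - a) ^ 2) := by gcongr
        _ = 16 * D * (t * (z - a)) ^ 2 := by ring
        _ ≤ 16 * D * 2 ^ 2 := by gcongr
        _ = 64 * D := by ring
    have h : y z ^ 2 ≤ 5 * y a ^ 2 + 5 / 4 * (y z - y a) ^ 2 := by
      nlinarith [sq_nonneg (y z - 5 * y a)]
    have := mul_le_mul_of_nonneg_left h ht0.le
    nlinarith
  rcases le_total x a with hxa | hax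
  · have hq : t ^ 2 ≤ t ^ 6 - x ^ 2 / 4 := by nlinarith
    have hs : t ≤ √(t ^ 6 - x ^ 2 / 4) := Real.le_sqrt_of_sq_le hq
    have h := (mul_sq_le_greenForm x (y x) (y' x) (ht0.trans_le hs)).trans (hosc hx hq)
    have := mul_le_mul_of_nonneg_right hs (sq_nonneg (y x))
    linarith
  · have hturn : a ≤ 2 * t ^ 3 := by
      refine abs_le_of_sq_le_sq' ?_ (by positivity) |>.2
      nlinarith
    rcases le_total x (2 * t ^ 3) with hx2 | hx2
    · exact hmid hax hx2
    · have h := sq_le_of_turning_point_le hy hy' hlim (by positivity) hx2 (le_of_eq (by ring))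
      exact (mul_le_mul_of_nonneg_left h ht0.le).trans (hmid hturn le_rfl)

end ODE

lemma tendsto_aeval_mul_exp_neg_sq (p : Polynomial ℤ) {a : ℝ} (ha : 0 < a) :
    Tendsto (fun x : ℝ => Polynomial.aeval x p * exp (-a * x ^ 2)) atTop (𝓝 0) := by
  have h := (p.map (Int.castRingHom ℝ)).tendsto_div_exp_atTop
  refine squeeze_zero_norm' ?_ (by simpa using h.norm)
  filter_upwards [eventually_ge_atTop (1 / a), eventually_ge_atTop 0] with x hx hx0
  have hexp : exp (-a * x ^ 2) ≤ (exp x)⁻¹ := by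
    rw [← exp_neg, exp_le_exp]
    have : 1 ≤ x * a := (div_le_iff₀ ha).1 hx
    nlinarith
  have e : Polynomial.aeval x p = (p.map (Int.castRingHom ℝ)).eval x := by
    rw [Polynomial.eval_map, Polynomial.aeval_def]
    rfl
  rw [e, norm_mul, Real.norm_eq_abs, Real.norm_eq_abs, abs_of_pos (exp_pos _),
    div_eq_mul_inv]
  gcongr

lemma mul_sq_H_mul_exp_neg_quarter_le (n : ℕ) {t : ℝ} (ht : 1 ≤ t) (htn : t ^ 6 = n + 1 / 2)
    {x : ℝ} (hx : 0 ≤ x) :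
    t * (H n x * exp (-(1 / 4) * x ^ 2)) ^ 2 ≤ 200 * n.factorial := by
  have hn : (0 : ℝ) ≤ n := n.cast_nonneg
  let y : ℝ → ℝ := fun x => H n x * exp (-(1 / 4) * x ^ 2)
  let y' : ℝ → ℝ := fun x => (x / 2 * H n x - H (n + 1) x) * exp (-(1 / 4) * x ^ 2)
  have hy (x : ℝ) : HasDerivAt y (y' x) x := by
    refine ((hasDerivAt_H n x).mul (hasDerivAt_exp_neg_mul_sq (1 / 4) x)).congr_deriv ?_
    simp only [y']
    ring
  have hy' (x : ℝ) : HasDerivAt y' (-(t ^ 6 - x ^ 2 / 4) * y x) x := by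
    refine (((((hasDerivAt_id x).div_const 2).mul (hasDerivAt_H n x)).sub
      (hasDerivAt_H_succ n x)).mul (hasDerivAt_exp_neg_mul_sq (1 / 4) x)).congr_deriv ?_
    simp only [y, htn, id, Pi.mul_apply, Pi.sub_apply]
    ring
  have hlim : Tendsto (fun x => y x * y' x) atTop (𝓝 0) := by
    have h₁ := tendsto_aeval_mul_exp_neg_sq
      (Polynomial.X * Polynomial.hermite n * Polynomial.hermite n) one_half_pos
    have h₂ := tendsto_aeval_mul_exp_neg_sq
      (Polynomial.hermite n * Polynomial.hermite (n + 1)) one_half_pos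
    have h := (h₁.const_mul (1 / 2)).sub h₂
    rw [mul_zero, sub_zero] at h
    refine h.congr fun x => ?_
    have e : exp (-(1 / 2) * x ^ 2) = exp (-(1 / 4) * x ^ 2) * exp (-(1 / 4) * x ^ 2) := by
      rw [← exp_add]
      ring_nf
    simp only [y, y', H, map_mul, Polynomial.aeval_X, e]
    ring
  refine (mul_sq_le_of_ode ht hy hy' hlim hx).trans ?_
  have ht3 : 0 < t ^ 3 := by positivity
  have ht6 : (t ^ 3) ^ 2 = n + 1 / 2 := by rw [← htn]; ring
  have h₁ : t ^ 3 * H n 0 ^ 2 ≤ n.factorial := by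
    have hle : t ^ 3 ≤ √((n : ℝ) + 1) := Real.le_sqrt_of_sq_le (by linarith)
    calc t ^ 3 * H n 0 ^ 2 ≤ √((n : ℝ) + 1) * H n 0 ^ 2 := by gcongr
      _ = H n 0 ^ 2 * √((n : ℝ) + 1) := mul_comm _ _
      _ ≤ n.factorial := sq_H_apply_zero_mul_sqrt_le n
  have h₂ : H (n + 1) 0 ^ 2 / t ^ 3 ≤ n.factorial := by
    have hle : (n : ℝ) + 1 ≤ t ^ 3 * √((n : ℝ) + 2) := by
      refine (abs_le_of_sq_le_sq' ?_ (by positivity)).2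
      rw [mul_pow, ht6, Real.sq_sqrt (by positivity)]
      nlinarith
    rw [div_le_iff₀ ht3]
    have hs : 0 < √((n : ℝ) + 2) := Real.sqrt_pos.2 (by positivity)
    refine le_of_mul_le_mul_right ?_ hs
    calc H (n + 1) 0 ^ 2 * √((n : ℝ) + 2) ≤ (n + 1) * n.factorial :=
          sq_H_succ_apply_zero_mul_sqrt_le n
      _ ≤ t ^ 3 * √((n : ℝ) + 2) * n.factorial := by gcongr
      _ = n.factorial * t ^ 3 * √((n : ℝ) + 2) := by ring
  have e : y 0 = H n 0 := by simp [y]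
  have e' : y' 0 ^ 2 = H (n + 1) 0 ^ 2 := by simp [y']
  rw [e, e']
  linarith

lemma abs_H_mul_exp_neg_quarter_le (n : ℕ) (hn : 1 ≤ n) (x : ℝ) :
    |H n x| * exp (-(1 / 4) * x ^ 2) ≤ 15 * √n.factorial * (n : ℝ) ^ (-(1 / 12) : ℝ) := by
  wlog hx : 0 ≤ x generalizing x
  · have h := this (-x) (by linarith)
    rwa [abs_H_neg, neg_sq] at h
  have hn' : (1 : ℝ) ≤ n := by exact_mod_cast hn
  have hn0 : (0 : ℝ) < n := by linarith
  set t : ℝ := ((n : ℝ) + 1 / 2) ^ (1 / 6 : ℝ) with ht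
  have htn : t ^ 6 = n + 1 / 2 := by
    rw [ht, ← Real.rpow_natCast, ← Real.rpow_mul (by positivity)]
    norm_num
  have h := mul_sq_H_mul_exp_neg_quarter_le n (Real.one_le_rpow (by linarith) (by norm_num)) htn hx
  have hle : (n : ℝ) ^ (1 / 6 : ℝ) ≤ t :=
    Real.rpow_le_rpow hn0.le (by linarith) (by norm_num)
  have hsq : ((n : ℝ) ^ (-(1 / 12) : ℝ)) ^ 2 = ((n : ℝ) ^ (1 / 6 : ℝ))⁻¹ := by
    rw [← Real.rpow_natCast, ← Real.rpow_mul hn0.le, ← Real.rpow_neg hn0.le]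
    norm_num
  refine (abs_le_of_sq_le_sq' ?_ (by positivity)).2
  rw [mul_pow, mul_pow, mul_pow, sq_abs, ← mul_pow, Real.sq_sqrt (by positivity), hsq,
    ← div_eq_mul_inv, le_div_iff₀ (by positivity)]
  have h' := mul_le_mul_of_nonneg_right hle (sq_nonneg (H n x * exp (-(1 / 4) * x ^ 2)))
  have : (0 : ℝ) ≤ n.factorial := by positivity
  linarith

lemma abs_H_mul_exp_neg_half_le (n : ℕ) (hn : 1 ≤ n) (x : ℝ) :
    |H n x| * exp (-(1 / 2) * x ^ 2) ≤ 15 * √n.factorial * (n : ℝ) ^ (-(1 / 4) : ℝ) := by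
  wlog hx : 0 ≤ x generalizing x
  · have h := this (-x) (by linarith)
    rwa [abs_H_neg, neg_sq] at h
  have hn0 : (0 : ℝ) < n := by exact_mod_cast hn
  have hs : 0 < √(n : ℝ) := Real.sqrt_pos.2 hn0
  have h := sq_H_mul_exp_neg_half_le n hx
  have h₁ : H n 0 ^ 2 * √(n : ℝ) ≤ n.factorial :=
    le_trans (by gcongr; linarith) (sq_H_apply_zero_mul_sqrt_le n)
  have h₂ : H (n + 1) 0 ^ 2 * √(n : ℝ) ≤ (n + 1) * n.factorial :=
    le_trans (by gcongr; linarith) (sq_H_succ_apply_zero_mul_sqrt_le n)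
  have h₃ : (H n x * exp (-(1 / 2) * x ^ 2)) ^ 2 * √(n : ℝ) ≤ 2 * n.factorial := by
    refine le_of_mul_le_mul_left ?_ (by positivity : (0 : ℝ) < n + 1)
    have := mul_le_mul_of_nonneg_right h hs.le
    nlinarith
  have hsq : ((n : ℝ) ^ (-(1 / 4) : ℝ)) ^ 2 = (√(n : ℝ))⁻¹ := by
    rw [← Real.rpow_natCast, ← Real.rpow_mul hn0.le, Real.sqrt_eq_rpow, ← Real.rpow_neg hn0.le]
    norm_num
  refine (abs_le_of_sq_le_sq' ?_ (by positivity)).2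
  rw [mul_pow, mul_pow, mul_pow, sq_abs, ← mul_pow, Real.sq_sqrt (by positivity), hsq,
    ← div_eq_mul_inv, le_div_iff₀ hs]
  have : (0 : ℝ) ≤ n.factorial := by positivity
  linarith

theorem stmt6 (α : ℝ) (hα : α ∈ Set.Icc (1 / 4 : ℝ) (1 / 2)) :
    ∃ c > (0 : ℝ), ∀ n : ℕ, 1 ≤ n → ∀ x : ℝ,
      |H n x * Real.exp (-α * x ^ 2)| ≤
        c * Real.sqrt (n.factorial) * (n : ℝ) ^ (-(8 * α - 1) / 12) := by
  refine ⟨15, by norm_num, fun n hn x => ?_⟩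
  have hn0 : (0 : ℝ) < n := by exact_mod_cast hn
  obtain ⟨hα₁, hα₂⟩ := hα
  have interp {u a b : ℝ} (hu : 0 < u) :
      (u * exp a) ^ (2 - 4 * α) * (u * exp b) ^ (4 * α - 1) =
        u * exp ((2 - 4 * α) * a + (4 * α - 1) * b) := by
    rw [Real.mul_rpow hu.le (exp_pos _).le, Real.mul_rpow hu.le (exp_pos _).le, ← exp_mul,
      ← exp_mul, mul_mul_mul_comm, ← Real.rpow_add hu, ← exp_add,
      show 2 - 4 * α + (4 * α - 1) = 1 by ring, Real.rpow_one, mul_comm a, mul_comm b]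
  rcases eq_or_ne (H n x) 0 with h0 | h0
  · rw [h0, zero_mul, abs_zero]
    positivity
  have hpow (r : ℝ) : (n : ℝ) ^ r = exp (r * Real.log n) := by
    rw [Real.rpow_def_of_pos hn0, mul_comm]
  have hA := abs_H_mul_exp_neg_quarter_le n hn x
  have hB := abs_H_mul_exp_neg_half_le n hn x
  rw [hpow] at hA hB ⊢
  have hc : 0 < 15 * √(n.factorial : ℝ) := by positivity
  have h := mul_le_mul
    (Real.rpow_le_rpow (by positivity) hA (by linarith : 0 ≤ 2 - 4 * α))
    (Real.rpow_le_rpow (by positivity) hB (by linarith : 0 ≤ 4 * α - 1))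
    (by positivity) (by positivity)
  rw [interp (abs_pos.2 h0), interp hc] at h
  rw [abs_mul, abs_of_pos (exp_pos _)]
  rw [show -α * x ^ 2 =
      (2 - 4 * α) * (-(1 / 4) * x ^ 2) + (4 * α - 1) * (-(1 / 2) * x ^ 2) by ring,
    show -(8 * α - 1) / 12 * Real.log n =
      (2 - 4 * α) * (-(1 / 12) * Real.log n) + (4 * α - 1) * (-(1 / 4) * Real.log n) by ring]
  exact h
end

section
/- Let n ≥ 1 and let B be the n × n real symmetric matrix with B_{i,i+1} = B_{i+1,i} = 1 for 1 ≤ i ≤ n−1, B_{n,n} = 1, and all other entries 0. Then the eigenvalues of B are exactly the n distinct numbers 2 cos((2j+1)π/(2n+1)), j = 0, 1, …, n−1. -/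
open Real Polynomial

/-- If `sin ((n + 1) θ) = sin (n θ)`, then `(sin θ, sin 2θ, …, sin nθ)` satisfies the
eigenvector equation with eigenvalue `2 cos θ` for the path matrix with a `1` in its last
diagonal entry. -/
theorem sum_path_mul_sin {n : ℕ} {θ : ℝ} (hθ : sin ((n + 1) * θ) = sin (n * θ)) (i : Fin n) :
    ∑ j : Fin n, (if (i : ℕ) + 1 = j ∨ (j : ℕ) + 1 = i ∨ ((i : ℕ) = n - 1 ∧ (j : ℕ) = n - 1)
      then (1 : ℝ) else 0) * sin (((j : ℕ) + 1 : ℝ) * θ) =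
    2 * cos θ * sin (((i : ℕ) + 1 : ℝ) * θ) := by
  obtain ⟨i, hi⟩ := i
  have hsplit (j : ℕ) :
      (if i + 1 = j ∨ j + 1 = i ∨ (i = n - 1 ∧ j = n - 1) then (1 : ℝ) else 0)
          * sin ((j + 1 : ℝ) * θ) =
        (if i + 1 = j then sin ((j + 1 : ℝ) * θ) else 0)
          + (if j + 1 = i then sin ((j + 1 : ℝ) * θ) else 0)
          + (if n - 1 = j then (if i = n - 1 then sin ((j + 1 : ℝ) * θ) else 0) else 0) := by
    split_ifs <;> first | omega | simp
  have hprev : ∑ j ∈ Finset.range n, (if j + 1 = i then sin ((j + 1 : ℝ) * θ) else 0) =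
      sin (i * θ) := by
    cases i with
    | zero => simp
    | succ k => simp [Nat.lt_of_succ_lt hi]
  have htrig : 2 * cos θ * sin ((i + 1 : ℝ) * θ) = sin ((i + 2 : ℝ) * θ) + sin (i * θ) := by
    rw [show (i + 2 : ℝ) * θ = (i + 1) * θ + θ by ring,
      show (i : ℝ) * θ = (i + 1) * θ - θ by ring, sin_add, sin_sub]
    ring
  rw [Fin.sum_univ_eq_sum_range (fun j : ℕ =>
    (if i + 1 = j ∨ j + 1 = i ∨ (i = n - 1 ∧ j = n - 1) then (1 : ℝ) else 0)
      * sin ((j + 1 : ℝ) * θ)) n]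
  simp only [hsplit, Finset.sum_add_distrib, hprev, htrig, Finset.sum_ite_eq, Finset.mem_range]
  by_cases hlast : i = n - 1
  · obtain rfl : n = i + 1 := by omega
    push_cast at hθ
    simp only [lt_irrefl, if_false, Nat.add_sub_cancel, Nat.lt_succ_self, if_true]
    rw [show (i + 2 : ℝ) = i + 1 + 1 by ring, hθ]
    ring
  · rw [if_pos (by omega), if_neg hlast]
    push_cast
    rw [show (i + 2 : ℝ) = i + 1 + 1 by ring]
    simp

/-- An eigenvector for `μ` makes `μ` a root of the characteristic polynomial. -/
theorem Matrix.isRoot_charpoly_of_mulVec_eq_smul {R ι : Type*} [CommRing R] [IsDomain R]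
    [Fintype ι] [DecidableEq ι]
    {A : Matrix ι ι R} {μ : R} {v : ι → R} (hv : v ≠ 0) (h : A.mulVec v = μ • v) :
    A.charpoly.IsRoot μ := by
  rw [Polynomial.IsRoot, Matrix.eval_charpoly]
  refine Matrix.exists_mulVec_eq_zero_iff.mp ⟨v, hv, ?_⟩
  rw [Matrix.sub_mulVec, h, Matrix.scalar_apply, ← Matrix.smul_one_eq_diagonal,
    Matrix.smul_mulVec, Matrix.one_mulVec, sub_self]

/-- A monic polynomial whose degree is the number of given distinct roots is the product of the
corresponding linear factors. -/
theorem Polynomial.Monic.eq_prod_X_sub_C_of_injective {K ι : Type*} [Field K] [Fintype ι]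
    {p : K[X]} (hp : p.Monic) (hdeg : p.natDegree = Fintype.card ι) {r : ι → K}
    (hr : Function.Injective r) (hroot : ∀ i, p.IsRoot (r i)) :
    p = ∏ i, (X - C (r i)) := by
  refine eq_of_monic_of_dvd_of_natDegree_le (monic_prod_X_sub_C r _) hp ?_ ?_
  · exact Finset.prod_dvd_of_coprime (fun i _ j _ hij => pairwise_coprime_X_sub_C hr hij)
      fun i _ => dvd_iff_isRoot.mpr (hroot i)
  · rw [hdeg, natDegree_finsetProd_X_sub_C_eq_card, Finset.card_univ]

theorem stmt13 (n : ℕ) (hn : 1 ≤ n) (B : Matrix (Fin n) (Fin n) ℝ)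
    (hB : ∀ i j : Fin n, B i j =
      if (i : ℕ) + 1 = j ∨ (j : ℕ) + 1 = i ∨ ((i : ℕ) = n - 1 ∧ (j : ℕ) = n - 1)
      then 1 else 0) :
    Function.Injective
      (fun j : Fin n => 2 * Real.cos ((2 * (j : ℝ) + 1) * Real.pi / (2 * n + 1))) ∧
    Matrix.charpoly B =
      ∏ j : Fin n,
        (X - C (2 * Real.cos ((2 * (j : ℝ) + 1) * Real.pi / (2 * n + 1)))) := by
  have hpos : (0 : ℝ) < 2 * n + 1 := by positivity
  have hangle_pos (j : Fin n) : 0 < (2 * (j : ℝ) + 1) * π / (2 * n + 1) := by positivity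
  have hangle_lt (j : Fin n) : (2 * (j : ℝ) + 1) * π / (2 * n + 1) < π := by
    have hj : (j : ℝ) < n := by exact_mod_cast j.2
    rw [div_lt_iff₀ hpos]
    nlinarith [pi_pos]
  have hinj : Function.Injective
      (fun j : Fin n => 2 * Real.cos ((2 * (j : ℝ) + 1) * Real.pi / (2 * n + 1))) := by
    intro i j hij
    have hcos := mul_left_cancel₀ two_ne_zero hij
    have hangle := injOn_cos ⟨(hangle_pos i).le, (hangle_lt i).le⟩
      ⟨(hangle_pos j).le, (hangle_lt j).le⟩ hcos
    rw [div_left_inj' hpos.ne', mul_left_inj' pi_ne_zero] at hangle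
    have : (i : ℝ) = j := by linarith
    exact Fin.ext (by exact_mod_cast this)
  refine ⟨hinj, B.charpoly_monic.eq_prod_X_sub_C_of_injective
    B.charpoly_natDegree_eq_dim hinj fun k => ?_⟩
  set θ := (2 * (k : ℝ) + 1) * π / (2 * n + 1) with hθ
  have hboundary : sin ((n + 1) * θ) = sin (n * θ) := by
    have h : ((n : ℝ) + 1) * θ = π - n * θ + k * (2 * π) := by
      rw [hθ]
      field_simp
      ring
    rw [h, sin_add_nat_mul_two_pi, sin_pi_sub]
  refine Matrix.isRoot_charpoly_of_mulVec_eq_smul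
    (v := fun j : Fin n => sin (((j : ℕ) + 1 : ℝ) * θ)) (fun hzero => ?_) ?_
  · have hsin : sin θ = 0 := by simpa using congrFun hzero ⟨0, hn⟩
    exact (sin_pos_of_pos_of_lt_pi (hangle_pos k) (hangle_lt k)).ne' hsin
  · ext i
    simp only [Matrix.mulVec, dotProduct, hB, Pi.smul_apply, smul_eq_mul]
    exact sum_path_mul_sin hboundary i
end

section
/- Let d ≥ 1 and n ≥ 1, and set κ_n = 2n(1 − cos(π/(2n+1))). Then for all x₁, …, x_n ∈ ℝ^d, with x₀ = 0, the inequality n ∑_{j=1}^n ‖x_j − x_{j−1}‖² ≥ κ_n ∑_{j=1}^n ‖x_j‖² holds, and κ_n is optimal: it is the smallest eigenvalue of the associated Hessian matrix A ⊗ I_d, whose full set of eigenvalues is {2n(1 − cos((2j+1)π/(2n+1))) : j = 0,…,n−1}, where A is the n × n matrix with diagonal entries A_{i,i} = 2n for 1 ≤ i ≤ n−1, A_{n,n} = n, entries −n on the sub- and super-diagonals, and zeros elsewhere. -/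
open Real Matrix Kronecker

/-- The increment `x_j - x_{j-1}`, with the convention `x₀ = 0`. -/
noncomputable def padDiff {n d : ℕ} (x : Fin n → EuclideanSpace ℝ (Fin d)) (j : Fin n) :
    EuclideanSpace ℝ (Fin d) :=
  (Fin.cons 0 x : Fin (n + 1) → EuclideanSpace ℝ (Fin d)) j.succ -
    (Fin.cons 0 x : Fin (n + 1) → EuclideanSpace ℝ (Fin d)) j.castSucc

/-- Discrete Hardy inequality: the positive function `sin (j θ)` serves as a ground state for the
Dirichlet form of the second difference operator. -/
theorem sum_sq_norm_sub_ge {E : Type*} [NormedAddCommGroup E] [InnerProductSpace ℝ E]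
    (θ : ℝ) (y : ℕ → E) (hy : y 0 = 0) (m : ℕ)
    (hpos : ∀ k : ℕ, 1 ≤ k → k ≤ m → 0 < sin (k * θ)) :
    (2 - 2 * cos θ) * ∑ j ∈ Finset.range m, ‖y (j + 1)‖ ^ 2
        + (sin ((m + 1) * θ) / sin (m * θ) - 1) * ‖y m‖ ^ 2
      ≤ ∑ j ∈ Finset.range m, ‖y (j + 1) - y j‖ ^ 2 := by
  induction m with
  | zero => simp [hy]
  | succ m ih =>
    have ih := ih fun k h1 h2 => hpos k h1 (by omega)
    have hb : 0 < sin ((m + 1) * θ) := by exact_mod_cast hpos (m + 1) (by omega) le_rfl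
    rw [Finset.sum_range_succ, Finset.sum_range_succ]
    push_cast
    have hrec : sin ((m + 1 + 1) * θ) = 2 * cos θ * sin ((m + 1) * θ) - sin (m * θ) := by
      rw [show ((m : ℝ) + 1 + 1) * θ = (m + 1) * θ + θ by ring,
        show (m : ℝ) * θ = (m + 1) * θ - θ by ring, sin_add, sin_sub]
      ring
    have hdiv : sin ((m + 1 + 1) * θ) / sin ((m + 1) * θ)
        = 2 * cos θ - sin (m * θ) / sin ((m + 1) * θ) := by
      rw [hrec]; field_simp
    rw [hdiv]
    have key : (1 - sin (m * θ) / sin ((m + 1) * θ)) * ‖y (m + 1)‖ ^ 2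
        + (1 - sin ((m + 1) * θ) / sin (m * θ)) * ‖y m‖ ^ 2 ≤ ‖y (m + 1) - y m‖ ^ 2 := by
      rcases Nat.eq_zero_or_pos m with rfl | hm
      · simp [hy]
      have ha : 0 < sin (m * θ) := hpos m hm (by omega)
      set a := sin (m * θ)
      set b := sin ((m + 1) * θ)
      have hcs := real_inner_le_norm (y (m + 1)) (y m)
      rw [norm_sub_sq_real]
      have hsq : 0 ≤ (a * ‖y (m + 1)‖ - b * ‖y m‖) ^ 2 / (a * b) := by positivity
      have hexp : (a * ‖y (m + 1)‖ - b * ‖y m‖) ^ 2 / (a * b)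
          = a / b * ‖y (m + 1)‖ ^ 2 - 2 * (‖y (m + 1)‖ * ‖y m‖) + b / a * ‖y m‖ ^ 2 := by
        field_simp
        ring
      linarith
    linarith

/-- The spectrum of a matrix is unchanged by tensoring with a nonempty identity matrix. -/
theorem spectrum_kronecker_one {m p : Type*} [Fintype m] [DecidableEq m] [Fintype p]
    [DecidableEq p] [Nonempty p] {K : Type*} [Field K] (A : Matrix m m K) :
    spectrum K (A ⊗ₖ (1 : Matrix p p K)) = spectrum K A := by
  ext μ
  have h : algebraMap K (Matrix (m × p) (m × p) K) μ - A ⊗ₖ (1 : Matrix p p K)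
      = (algebraMap K (Matrix m m K) μ - A) ⊗ₖ (1 : Matrix p p K) := by
    ext ⟨i, k⟩ ⟨j, l⟩
    simp only [Matrix.algebraMap_eq_diagonal, Matrix.sub_apply, Matrix.kroneckerMap_apply,
      Matrix.diagonal_apply, Matrix.one_apply, Prod.mk.injEq, Pi.algebraMap_apply]
    split_ifs <;> simp_all
  rw [spectrum.mem_iff, spectrum.mem_iff, h, Matrix.isUnit_iff_isUnit_det,
    Matrix.isUnit_iff_isUnit_det, Matrix.det_kronecker]
  simp

/-- A scalar with a nonzero eigenvector belongs to the spectrum. -/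
theorem mem_spectrum_of_mulVec_eq {m : Type*} [Fintype m] [DecidableEq m] {K : Type*} [Field K]
    {A : Matrix m m K} {μ : K} {v : m → K} (hv : v ≠ 0) (h : A *ᵥ v = μ • v) :
    μ ∈ spectrum K A := by
  rw [spectrum.mem_iff, Matrix.isUnit_iff_isUnit_det, isUnit_iff_ne_zero, not_not,
    ← Matrix.exists_mulVec_eq_zero_iff]
  refine ⟨v, hv, ?_⟩
  rw [Matrix.sub_mulVec, h, Algebra.algebraMap_eq_smul_one, Matrix.smul_mulVec, Matrix.one_mulVec,
    sub_self]

/-- An `n × n` matrix with `n` distinct known eigenvalues has no others. -/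
theorem spectrum_eq_range_of_injective {m : Type*} [Fintype m] [DecidableEq m] {K : Type*}
    [Field K] (A : Matrix m m K) (f : m → K) (hf : Function.Injective f)
    (h : ∀ j, f j ∈ spectrum K A) : spectrum K A = Set.range f := by
  classical
  have hroots : ∀ μ, μ ∈ A.charpoly.roots.toFinset ↔ μ ∈ spectrum K A := fun μ => by
    rw [Multiset.mem_toFinset, Polynomial.mem_roots A.charpoly_monic.ne_zero,
      Matrix.mem_spectrum_iff_isRoot_charpoly]
  have himage : Finset.univ.image f = A.charpoly.roots.toFinset := by
    refine Finset.eq_of_subset_of_card_le ?_ ?_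
    · intro μ hμ
      obtain ⟨j, -, rfl⟩ := Finset.mem_image.1 hμ
      exact (hroots _).2 (h j)
    · rw [Finset.card_image_of_injective _ hf, Finset.card_univ,
        ← A.charpoly_natDegree_eq_dim]
      exact (Multiset.toFinset_card_le _).trans (Polynomial.card_roots' _)
  ext μ
  rw [← hroots, ← himage]
  simp

/-- The angles `(2j+1)π/(2n+1)`, `j < n`, lie in `(0, π)`. -/
theorem angle_mem_Ioo {n j : ℕ} (hj : j < n) :
    (2 * (j : ℝ) + 1) * π / (2 * n + 1) ∈ Set.Ioo 0 π := by
  have h : (j : ℝ) < n := by exact_mod_cast hj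
  refine ⟨by positivity, ?_⟩
  rw [div_lt_iff₀ (by positivity)]
  nlinarith [pi_pos]

/-- At the angles `(2j+1)π/(2n+1)` the sine sequence satisfies the free boundary condition. -/
theorem sin_succ_mul_angle_eq (n j : ℕ) :
    sin ((n + 1) * ((2 * (j : ℝ) + 1) * π / (2 * n + 1)))
      = sin (n * ((2 * (j : ℝ) + 1) * π / (2 * n + 1))) := by
  have hn : (2 * (n : ℝ) + 1) ≠ 0 := by positivity
  have h : ((n : ℝ) + 1) * ((2 * (j : ℝ) + 1) * π / (2 * n + 1))
      = π - n * ((2 * (j : ℝ) + 1) * π / (2 * n + 1)) + j * (2 * π) := by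
    field_simp
    ring
  rw [h, sin_add_nat_mul_two_pi, sin_pi_sub]

/-- The vector `sin (i θ)`, `i = 1, …, n`, is an eigenvector of the Brownian Hessian when
`sin ((n+1) θ) = sin (n θ)`. -/
theorem mulVec_sin_eq {n : ℕ} (A : Matrix (Fin n) (Fin n) ℝ)
    (hA : ∀ i j : Fin n, A i j =
      if i = j then (if (i : ℕ) = n - 1 then (n : ℝ) else 2 * n)
      else if (i : ℕ) + 1 = j ∨ (j : ℕ) + 1 = i then -(n : ℝ) else 0)
    (θ : ℝ) (hθ : sin ((n + 1) * θ) = sin (n * θ)) :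
    A *ᵥ (fun i : Fin n => sin (((i : ℕ) + 1) * θ))
      = (2 * n * (1 - cos θ)) • fun i : Fin n => sin (((i : ℕ) + 1) * θ) := by
  ext i
  simp only [Matrix.mulVec, dotProduct, Pi.smul_apply, smul_eq_mul]
  obtain ⟨i, hi⟩ := i
  have hrec : sin (((i : ℝ) + 1 + 1) * θ) = 2 * cos θ * sin ((i + 1) * θ) - sin (i * θ) := by
    rw [show ((i : ℝ) + 1 + 1) * θ = (i + 1) * θ + θ by ring,
      show (i : ℝ) * θ = (i + 1) * θ - θ by ring, sin_add, sin_sub]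
    ring
  have hterm : ∀ j : Fin n, A ⟨i, hi⟩ j * sin (((j : ℕ) + 1) * θ)
      = (if (j : ℕ) = i then (if i = n - 1 then (n : ℝ) else 2 * n) * sin ((i + 1) * θ) else 0)
        + (if (j : ℕ) = i + 1 then -(n : ℝ) * sin ((i + 1 + 1) * θ) else 0)
        + (if (j : ℕ) + 1 = i then -(n : ℝ) * sin (i * θ) else 0) := by
    rintro ⟨j, hj⟩
    rw [hA]
    simp only [Fin.mk.injEq]
    rcases lt_trichotomy j i with h | rfl | h
    · by_cases h' : j + 1 = i
      · subst h'
        simp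
        intro h; omega
      · simp [h.ne, h.ne', h', show i + 1 ≠ j by omega, show j ≠ i + 1 by omega]
    · simp
    · by_cases h' : j = i + 1
      · subst h'
        simp
        intro h; omega
      · simp [h.ne, h.ne', h', show ¬ i + 1 = j by omega, show j + 1 ≠ i by omega]
  rw [Finset.sum_congr rfl fun j _ => hterm j, Finset.sum_add_distrib, Finset.sum_add_distrib,
    Fin.sum_univ_eq_sum_range (fun j => if j = i then
      (if i = n - 1 then (n : ℝ) else 2 * n) * sin ((i + 1) * θ) else 0),
    Fin.sum_univ_eq_sum_range (fun j => if j = i + 1 then -(n : ℝ) * sin ((i + 1 + 1) * θ) else 0),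
    Fin.sum_univ_eq_sum_range (fun j => if j + 1 = i then -(n : ℝ) * sin (i * θ) else 0),
    Finset.sum_ite_eq', Finset.sum_ite_eq', if_pos (Finset.mem_range.2 hi)]
  have hlow : ∑ j ∈ Finset.range n, (if j + 1 = i then -(n : ℝ) * sin (i * θ) else 0)
      = -(n : ℝ) * sin (i * θ) := by
    rcases i with _ | k
    · simp
    · simp only [Nat.add_right_cancel_iff]
      rw [Finset.sum_ite_eq', if_pos (Finset.mem_range.2 (by omega))]
  rw [hlow]
  by_cases hlast : i = n - 1
  · have hni : (n : ℝ) = i + 1 := by exact_mod_cast (by omega : n = i + 1)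
    rw [if_pos hlast, if_neg (by simp; omega)]
    rw [hni] at hθ ⊢
    linear_combination ((i : ℝ) + 1) * (hθ - hrec)
  · rw [if_neg hlast, if_pos (Finset.mem_range.2 (by omega)), hrec]
    ring

/-- The discrete Poincaré inequality for paths started at the origin. -/
theorem mul_sum_sq_norm_le_padDiff {d n : ℕ} (hn : 1 ≤ n)
    (x : Fin n → EuclideanSpace ℝ (Fin d)) :
    2 * n * (1 - cos (π / (2 * n + 1))) * ∑ j : Fin n, ‖x j‖ ^ 2
      ≤ n * ∑ j : Fin n, ‖padDiff x j‖ ^ 2 := by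
  set θ : ℝ := π / (2 * n + 1) with hθ
  let y : ℕ → EuclideanSpace ℝ (Fin d) := fun k =>
    if h : k < n + 1 then (Fin.cons 0 x : Fin (n + 1) → EuclideanSpace ℝ (Fin d)) ⟨k, h⟩ else 0
  have hθpos : 0 < θ := by positivity
  have hmul : (2 * n + 1) * θ = π := by rw [hθ]; field_simp
  have hpos : ∀ k : ℕ, 1 ≤ k → k ≤ n → 0 < sin (k * θ) := fun k h1 h2 => by
    have h1' : (1 : ℝ) ≤ k := by exact_mod_cast h1
    have h2' : (k : ℝ) ≤ n := by exact_mod_cast h2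
    exact sin_pos_of_pos_of_lt_pi (by positivity) (by nlinarith)
  have hy : ∀ j : Fin n, y (j + 1) = x j := fun j => by
    have : y (j + 1) = (Fin.cons 0 x : Fin (n + 1) → EuclideanSpace ℝ (Fin d)) j.succ :=
      dif_pos (by omega)
    rw [this, Fin.cons_succ]
  have hdiff : ∀ j : Fin n, y (j + 1) - y j = padDiff x j := fun j => by
    have h1 : y (j + 1) = (Fin.cons 0 x : Fin (n + 1) → EuclideanSpace ℝ (Fin d)) j.succ :=
      dif_pos (by omega)
    have h2 : y j = (Fin.cons 0 x : Fin (n + 1) → EuclideanSpace ℝ (Fin d)) j.castSucc :=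
      dif_pos (by omega)
    rw [h1, h2, padDiff]
  have h := sum_sq_norm_sub_ge θ y (by simp [y]) n hpos
  have hfree : sin ((n + 1) * θ) = sin (n * θ) := by
    simpa [hθ] using sin_succ_mul_angle_eq n 0
  rw [hfree, div_self (hpos n hn le_rfl).ne', sub_self, zero_mul, add_zero,
    ← Fin.sum_univ_eq_sum_range (fun j => ‖y (j + 1)‖ ^ 2),
    ← Fin.sum_univ_eq_sum_range (fun j => ‖y (j + 1) - y j‖ ^ 2)] at h
  simp only [hdiff] at h
  simp only [hy] at h
  calc _ = n * ((2 - 2 * cos θ) * ∑ j : Fin n, ‖x j‖ ^ 2) := by ring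
    _ ≤ _ := by gcongr

theorem stmt14 (d n : ℕ) (hd : 1 ≤ d) (hn : 1 ≤ n)
    (A : Matrix (Fin n) (Fin n) ℝ)
    (hA : ∀ i j : Fin n, A i j =
      if i = j then (if (i : ℕ) = n - 1 then (n : ℝ) else 2 * n)
      else if (i : ℕ) + 1 = j ∨ (j : ℕ) + 1 = i then -(n : ℝ) else 0) :
    (∀ x : Fin n → EuclideanSpace ℝ (Fin d),
        2 * n * (1 - Real.cos (Real.pi / (2 * n + 1))) * ∑ j : Fin n, ‖x j‖ ^ 2
          ≤ n * ∑ j : Fin n, ‖padDiff x j‖ ^ 2) ∧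
    spectrum ℝ (A ⊗ₖ (1 : Matrix (Fin d) (Fin d) ℝ))
      = Set.range
          (fun j : Fin n => 2 * n * (1 - Real.cos ((2 * (j : ℝ) + 1) * Real.pi / (2 * n + 1)))) ∧
    IsLeast (spectrum ℝ (A ⊗ₖ (1 : Matrix (Fin d) (Fin d) ℝ)))
      (2 * n * (1 - Real.cos (Real.pi / (2 * n + 1)))) := by
  have : Nonempty (Fin d) := ⟨⟨0, hd⟩⟩
  have hspec : spectrum ℝ (A ⊗ₖ (1 : Matrix (Fin d) (Fin d) ℝ))
      = Set.range
          (fun j : Fin n => 2 * n * (1 - cos ((2 * (j : ℝ) + 1) * π / (2 * n + 1)))) := by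
    rw [spectrum_kronecker_one]
    refine spectrum_eq_range_of_injective A _ ?_ fun j => ?_
    · intro j k hjk
      have hcos : cos ((2 * (j : ℝ) + 1) * π / (2 * n + 1))
          = cos ((2 * (k : ℝ) + 1) * π / (2 * n + 1)) := by
        have := mul_left_cancel₀ (by positivity) hjk
        linarith
      have hangle := injOn_cos (Set.Ioo_subset_Icc_self (angle_mem_Ioo j.2))
        (Set.Ioo_subset_Icc_self (angle_mem_Ioo k.2)) hcos
      field_simp at hangle
      have hjk' : (j : ℝ) = k := by linarith
      exact Fin.ext (by exact_mod_cast hjk')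
    · refine mem_spectrum_of_mulVec_eq (fun h0 => ?_)
        (mulVec_sin_eq A hA _ (sin_succ_mul_angle_eq n j))
      have hsin := sin_pos_of_mem_Ioo (angle_mem_Ioo j.2)
      have := congrFun h0 ⟨0, hn⟩
      simp at this
      exact hsin.ne' this
  refine ⟨mul_sum_sq_norm_le_padDiff hn, hspec, ?_⟩
  rw [hspec]
  refine ⟨⟨⟨0, hn⟩, by simp⟩, ?_⟩
  rintro _ ⟨j, rfl⟩
  have hcos : cos ((2 * (j : ℝ) + 1) * π / (2 * n + 1)) ≤ cos (π / (2 * n + 1)) := by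
    refine cos_le_cos_of_nonneg_of_le_pi (by positivity) (angle_mem_Ioo j.2).2.le ?_
    gcongr
    nlinarith [pi_pos, (Nat.cast_nonneg j : (0 : ℝ) ≤ ((j : ℕ) : ℝ))]
  dsimp only
  gcongr
end
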